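/- (Dual Nešetřil–Rödl Theorem, restricted form.) Let Θ be a relational language and let ⊏ ∉ Θ be a binary relational symbol. Then the category Rel_srq(Θ, ⊏), whose objects are all finite linearly ordered reflexive Θ-structures and whose morphisms are strong rigid quotient maps of structures, has the dual Ramsey property. -/

import Mathlib

open scoped Classical

noncomputable section

/-! ### Basic notions: anti-lexicographic order, types, matrices,
special anti-lexicographic order, rigid surjections -/

/-- `altLex X Y` : the anti-lexicographic order `⊏_alex` on subsets of a chain,
comparing characteristic vectors anti-lexicographically (`0 < 1`), i.e. the
`⊏`-largest element on which `X` and `Y` differ belongs to `Y`. -/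
def altLex {A : Type*} [LinearOrder A] (X Y : Finset A) : Prop :=
  ∃ m, m ∈ Y ∧ m ∉ X ∧ ∀ z, m < z → (z ∈ X ↔ z ∈ Y)

/-- The `≡_σ`-equivalence class of `i` within `{0, …, n-1}`, for a
(total quasi)order `σ` on `{0, …, n-1}`. -/
def classOf (σ : ℕ → ℕ → Prop) (n i : ℕ) : Finset ℕ :=
  (Finset.range n).filter fun j => σ i j ∧ σ j i

/-- The set of `≡_σ`-equivalence classes. -/
def classesOf (σ : ℕ → ℕ → Prop) (n : ℕ) : Finset (Finset ℕ) :=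
  (Finset.range n).image (classOf σ n)

/-- `σ ◁ τ` : the linear order on total quasiorders on `{0, …, n-1}` : `σ ◁ τ` if `σ`
has fewer classes, or they have equally many classes and the tuples of classes, each
listed in `<_alex`-increasing order, compare anti-lexicographically w.r.t. `<_alex`
(for such increasing enumerations of two families of sets this amounts to: the
`<_alex`-largest class in which the two families differ belongs to the family of
classes of `τ`). -/
def quasiLT (n : ℕ) (σ τ : ℕ → ℕ → Prop) : Prop :=
  (classesOf σ n).card < (classesOf τ n).card ∨
    ((classesOf σ n).card = (classesOf τ n).card ∧
      ∃ M, M ∈ classesOf τ n ∧ M ∉ classesOf σ n ∧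
        ∀ X, altLex M X → (X ∈ classesOf σ n ↔ X ∈ classesOf τ n))

/-- `IsTotalQuasiorder n σ` : `σ` is a total quasiorder on `{0, …, n-1}`. -/
def IsTotalQuasiorder (n : ℕ) (σ : ℕ → ℕ → Prop) : Prop :=
  (∀ i j, σ i j → i < n ∧ j < n) ∧ (∀ i < n, σ i i) ∧
    (∀ i j k, σ i j → σ j k → σ i k) ∧ ∀ i j, i < n → j < n → σ i j ∨ σ j i

/-- The type `tp(ā)` of a tuple (represented as a list): the total quasiorder
`{(i,j) : a_i ⊑ a_j}` on the set of positions of the list. -/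
def tpRel {A : Type*} [LinearOrder A] (l : List A) : ℕ → ℕ → Prop :=
  fun i j => ∃ (hi : i < l.length) (hj : j < l.length), l.get ⟨i, hi⟩ ≤ l.get ⟨j, hj⟩

/-- The special anti-lexicographic order `⊏_sal` on tuples (represented as lists):
`ā ⊏_sal b̄` iff `tp(ā) ◁ tp(b̄)`, or the types coincide, the sets of entries
differ and the set of entries of `ā` is `⊏_alex`-below that of `b̄`. -/
def salLT {A : Type*} [LinearOrder A] (l₁ l₂ : List A) : Prop :=
  l₁.length = l₂.length ∧
    (quasiLT l₁.length (tpRel l₁) (tpRel l₂) ∨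
      (tpRel l₁ = tpRel l₂ ∧ l₁.toFinset ≠ l₂.toFinset ∧ altLex l₁.toFinset l₂.toFinset))

/-- The matrix `mat(ā)` of a tuple: the `⊏`-increasing enumeration of its set of
entries (one representative from each `≡_{tp(ā)}`-class, in increasing order). -/
def matL {A : Type*} [LinearOrder A] (l : List A) : List A :=
  l.toFinset.sort (· ≤ ·)

/-- The number of `≡_σ`-classes strictly `≺_σ`-below the class of `i`. -/
def classRank (σ : ℕ → ℕ → Prop) (n i : ℕ) : ℕ :=
  (((Finset.range n).filter fun j => σ j i ∧ ¬ σ i j).image (classOf σ n)).card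

/-- `tup σ n b` : the `n`-tuple obtained by placing the `ξ`-th entry of `b` on all
coordinates belonging to the `ξ`-th `≡_σ`-class (classes enumerated in the
`≺_σ`-increasing order). -/
def tup {A : Type*} [Nonempty A] (σ : ℕ → ℕ → Prop) (n : ℕ) (b : List A) : List A :=
  (List.range n).map fun i => b.getD (classRank σ n i) (Classical.arbitrary A)

/-- `m` is the minimum of `S` with respect to a strict order `lt`. -/
def MinWrt {α : Type*} (lt : α → α → Prop) (S : Set α) (m : α) : Prop :=
  m ∈ S ∧ ∀ x ∈ S, x = m ∨ lt m x

/-- `f` maps `S` onto `T` and is rigid w.r.t. the strict orders `ltA`, `ltB`: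
minima of preimages of `ltB`-comparable elements are `ltA`-comparable in the
same order. -/
def IsRigidSurjOn {α β : Type*} (ltA : α → α → Prop) (ltB : β → β → Prop)
    (S : Set α) (T : Set β) (f : α → β) : Prop :=
  (∀ a ∈ S, f a ∈ T) ∧ (∀ b ∈ T, ∃ a ∈ S, f a = b) ∧
    ∀ x ∈ T, ∀ y ∈ T, ltB x y → ∀ a b, MinWrt ltA {u | u ∈ S ∧ f u = x} a →
      MinWrt ltA {u | u ∈ S ∧ f u = y} b → ltA a b

/-- A rigid surjection between chains: a surjection such that
`min f⁻¹(x) ⊏ min f⁻¹(y)` whenever `x ⊏' y`. -/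
def IsRigidSurjection {A B : Type*} [LinearOrder A] [LinearOrder B] (f : A → B) : Prop :=
  Function.Surjective f ∧ ∀ x y : B, x < y → ∀ a b : A,
    IsLeast {u | f u = x} a → IsLeast {v | f v = y} b → a < b

/-! ### The dual Ramsey property for a class of objects with
designated surjective morphisms.

`C ⟶ (B)^A_k` in `C^op` unfolds to: for every `k`-colouring `χ` of the
morphisms `C → A` there are `w : C → B` and a colour `i` such that
`χ(g ∘ w) = i` for every morphism `g : B → A`.  -/

/-- The dual Ramsey property for the (full) subcategory spanned by `S` of the category
whose objects are `Obj` and whose morphisms `X → Y` are the functions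
`carrier X → carrier Y` satisfying `IsMor X Y`. -/
def HasDualRamseySub {Obj : Type*} (carrier : Obj → Type*)
    (IsMor : ∀ X Y : Obj, (carrier X → carrier Y) → Prop) (S : Set Obj) : Prop :=
  ∀ k : ℕ, 2 ≤ k → ∀ A ∈ S, ∀ B ∈ S, (∃ f : carrier B → carrier A, IsMor B A f) →
    ∃ C ∈ S, ∀ χ : (carrier C → carrier A) → Fin k,
      ∃ w : carrier C → carrier B, IsMor C B w ∧ ∃ i : Fin k,
        ∀ g : carrier B → carrier A, IsMor B A g → χ (g ∘ w) = i

/-- The dual Ramsey property for the category whose objects are `Obj` and whose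
morphisms `X → Y` are the functions `carrier X → carrier Y` satisfying `IsMor X Y`. -/
def HasDualRamseyClass {Obj : Type*} (carrier : Obj → Type*)
    (IsMor : ∀ X Y : Obj, (carrier X → carrier Y) → Prop) : Prop :=
  HasDualRamseySub carrier IsMor Set.univ

end

noncomputable section

/-- A finite linearly ordered reflexive `Θ`-structure, for the relational language
with symbols `Θ` and arities `ar` (with `⊏ ∉ Θ`); a `θ`-tuple is represented as a
list of length `ar θ`. Each relation contains all constant tuples. -/
structure ORelObj (Θ : Type*) (ar : Θ → ℕ) where
  carrier : Type
  [fintypeI : Fintype carrier]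
  [linearOrderI : LinearOrder carrier]
  rel : Θ → Set (List carrier)
  len : ∀ θ : Θ, ∀ l ∈ rel θ, l.length = ar θ
  refl : ∀ θ : Θ, ∀ a : carrier, List.replicate (ar θ) a ∈ rel θ

attribute [instance] ORelObj.fintypeI ORelObj.linearOrderI

/-- Strong rigid quotient maps of structures: homomorphisms `f` such that for every
`θ ∈ Θ` (i) the coordinatewise extension `f̂ : (θ^A,⊏_sal^A) → (θ^B,⊏_sal^B)` is a
rigid surjection, and (ii) `f` is strictly increasing on the entries of every
`θ^A`-tuple on which it is not constant. The morphisms of `Rel_srq(Θ,⊏)`. -/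
def IsSRQstr {Θ : Type*} {ar : Θ → ℕ} (M N : ORelObj Θ ar)
    (f : M.carrier → N.carrier) : Prop :=
  ∀ θ : Θ, (∀ l ∈ M.rel θ, l.map f ∈ N.rel θ) ∧
    IsRigidSurjOn salLT salLT (M.rel θ) (N.rel θ) (List.map f) ∧
    ∀ l ∈ M.rel θ, (¬ ∀ x ∈ l, ∀ y ∈ l, f x = f y) →
      ∀ x ∈ l, ∀ y ∈ l, x < y → f x < f y

/-- Restricted growth: every value below a value of `f` is attained earlier. -/
def RestrictedGrowth (f : ℕ → ℕ) : Prop := ∀ i, ∀ v < f i, ∃ j < i, f j = v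

/-- `IsParamWord a n k f`: `f` codes a `k`-parameter word of length `n` over the alphabet
`{0, …, a - 1}`; the letters are fixed points of `f`, the letter at position `i` of the word is
`f (a + i)`, the parameters are `a, …, a + k - 1`, and `f` is extended by a shift, so that
substitution of words is composition of functions. -/
structure IsParamWord (a n k : ℕ) (f : ℕ → ℕ) : Prop where
  growth : RestrictedGrowth f
  fixed : ∀ i < a, f i = i
  bound : ∀ i < a + n, f i < a + k
  tail : ∀ j, f (a + n + j) = a + k + j

theorem RestrictedGrowth.comp {f g : ℕ → ℕ} (hg : RestrictedGrowth g) (hf : RestrictedGrowth f) :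
    RestrictedGrowth (g ∘ f) := by
  intro i v hv
  obtain ⟨u, hu, rfl⟩ := hg _ _ hv
  obtain ⟨j, hj, rfl⟩ := hf _ _ hu
  exact ⟨j, hj, rfl⟩

theorem IsParamWord.comp {a n m k : ℕ} {f g : ℕ → ℕ} (hg : IsParamWord a m k g)
    (hf : IsParamWord a n m f) : IsParamWord a n k (g ∘ f) where
  growth := hg.growth.comp hf.growth
  fixed i hi := by simp [hf.fixed i hi, hg.fixed i hi]
  bound i hi := hg.bound _ (hf.bound i hi)
  tail j := by simp [hf.tail, hg.tail]

theorem IsParamWord.refl (a n : ℕ) : IsParamWord a n n id :=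
  ⟨fun _ v hv => ⟨v, hv, rfl⟩, fun _ _ => rfl, fun _ h => h, fun _ => rfl⟩

theorem IsParamWord.extend {a n k : ℕ} {f : ℕ → ℕ} (hf : IsParamWord a n k f) (r : ℕ) :
    IsParamWord a (n + r) (k + r) f where
  growth := hf.growth
  fixed := hf.fixed
  bound i hi := by
    by_cases h : i < a + n
    · have := hf.bound i h
      omega
    · have := hf.tail (i - (a + n))
      rw [show a + n + (i - (a + n)) = i by omega] at this
      omega
  tail j := by
    have := hf.tail (r + j)
    rw [show a + (n + r) + j = a + n + (r + j) by omega]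
    omega

theorem IsParamWord.of_succ {a n k : ℕ} {f : ℕ → ℕ} (hf : IsParamWord (a + 1) n k f) :
    IsParamWord a (n + 1) (k + 1) f where
  growth := hf.growth
  fixed i hi := hf.fixed i (by omega)
  bound i hi := by
    have := hf.bound i (by omega)
    omega
  tail j := by
    have := hf.tail j
    rw [show a + (n + 1) + j = a + 1 + n + j by omega]
    omega

/-- Every parameter has a first occurrence, preceded by letters and smaller parameters only. -/
theorem IsParamWord.exists_first {a n k p : ℕ} {f : ℕ → ℕ} (hf : IsParamWord a n k f)
    (hp : p < k) : ∃ N < n, f (a + N) = a + p ∧ ∀ i < a + N, f i < a + p := by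
  have hex : ∃ j, j < a + n ∧ f j = a + p := by
    have h0 := hf.tail 0
    exact hf.growth (a + n) (a + p) (by simp only [Nat.add_zero] at h0; omega)
  obtain ⟨hj, hjp⟩ := Nat.find_spec hex
  have hmin := fun i => Nat.find_min hex (m := i)
  generalize Nat.find hex = j at hj hjp hmin
  have haj : a ≤ j := by
    by_contra h
    have := hf.fixed j (by omega)
    omega
  refine ⟨j - a, by omega, by rwa [show a + (j - a) = j by omega], fun i hi => ?_⟩
  have hij : i < j := by omega
  by_contra hlt
  rcases Nat.lt_or_ge (a + p) (f i) with h | h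
  · obtain ⟨t, ht, htp⟩ := hf.growth i _ h
    exact hmin t (by omega) ⟨by omega, htp⟩
  · exact hmin i hij ⟨by omega, by omega⟩

/-- The word without parameters with letters `y`. -/
def letterWord {a l : ℕ} (y : Fin l → Fin a) (i : ℕ) : ℕ :=
  if i < a then i else if h : i - a < l then y ⟨i - a, h⟩ else i - l

theorem letterWord_of_lt {a l i : ℕ} (y : Fin l → Fin a) (h : i < a) : letterWord y i = i := by
  simp [letterWord, h]

theorem letterWord_lt {a l i : ℕ} (y : Fin l → Fin a) (h : i < a + l) : letterWord y i < a := by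
  unfold letterWord
  split_ifs with h1 h2
  · exact h1
  · exact (y _).2
  · omega

theorem letterWord_of_ge {a l i : ℕ} (y : Fin l → Fin a) (h : a + l ≤ i) :
    letterWord y i = i - l := by
  unfold letterWord
  rw [if_neg (by omega), dif_neg (by omega)]

theorem isParamWord_letterWord {a l : ℕ} (y : Fin l → Fin a) :
    IsParamWord a l 0 (letterWord y) where
  growth i v hv := by
    by_cases h1 : i < a + l
    · have := letterWord_lt y h1
      refine ⟨v, ?_, letterWord_of_lt y (by omega)⟩
      by_contra hvi
      rw [letterWord_of_lt y (by omega)] at hv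
      omega
    · rw [letterWord_of_ge y (by omega)] at hv
      by_cases hva : v < a
      · exact ⟨v, by omega, letterWord_of_lt y hva⟩
      · exact ⟨v + l, by omega, by rw [letterWord_of_ge y (by omega)]; omega⟩
  fixed i hi := letterWord_of_lt y hi
  bound i hi := letterWord_lt y hi
  tail j := by rw [letterWord_of_ge y (by omega)]; omega

/-- The word `v` preceded by `p` new parameters. -/
def shiftWord (a p : ℕ) (v : ℕ → ℕ) (i : ℕ) : ℕ :=
  if i < a + p then i else if v (i - p) < a then v (i - p) else v (i - p) + p

theorem shiftWord_of_lt {a p i : ℕ} (v : ℕ → ℕ) (h : i < a + p) : shiftWord a p v i = i :=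
  if_pos h

theorem letterWord_comp_shiftWord {a p : ℕ} (y : Fin p → Fin a) {v : ℕ → ℕ}
    (hv : ∀ i < a, v i = i) : letterWord y ∘ shiftWord a p v = v ∘ letterWord y := by
  funext i
  simp only [Function.comp_apply]
  by_cases h : i < a + p
  · rw [shiftWord_of_lt v h, hv _ (letterWord_lt y h)]
  · rw [letterWord_of_ge y (show a + p ≤ i by omega), shiftWord, if_neg h]
    split_ifs with h2
    · exact letterWord_of_lt y h2
    · rw [letterWord_of_ge y (by omega)]
      omega

theorem IsParamWord.shiftWord {a r k : ℕ} (p : ℕ) {v : ℕ → ℕ} (hv : IsParamWord a r k v) :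
    IsParamWord a (p + r) (p + k) (shiftWord a p v) where
  growth i u hu := by
    by_cases h : i < a + p
    · rw [shiftWord_of_lt v h] at hu
      exact ⟨u, hu, shiftWord_of_lt v (by omega)⟩
    · by_cases hup : u < a + p
      · exact ⟨u, by omega, shiftWord_of_lt v hup⟩
      · have hu2 : u < v (i - p) + p := by
          rw [_root_.shiftWord, if_neg h] at hu
          split_ifs at hu <;> omega
        obtain ⟨j, hj, hju⟩ := hv.growth (i - p) (u - p) (by omega)
        have haj : a ≤ j := by
          by_contra hja
          have := hv.fixed j (by omega)
          omega
        refine ⟨j + p, by omega, ?_⟩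
        rw [_root_.shiftWord, if_neg (by omega), Nat.add_sub_cancel, if_neg (by omega)]
        omega
  fixed i hi := shiftWord_of_lt v (by omega)
  bound i hi := by
    by_cases h : i < a + p
    · rw [shiftWord_of_lt v h]
      omega
    · have := hv.bound (i - p) (by omega)
      rw [_root_.shiftWord, if_neg h]
      split_ifs <;> omega
  tail j := by
    have := hv.tail j
    rw [_root_.shiftWord, if_neg (by omega), show a + (p + r) + j - p = a + r + j by omega,
      if_neg (by omega)]
    omega

/-- The one-parameter word given by a combinatorial line. -/
def lineWord {a l : ℕ} (L : Combinatorics.Subspace Unit (Fin a) (Fin l)) (i : ℕ) : ℕ :=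
  if i < a then i else if h : i - a < l then
    Sum.elim (fun b : Fin a => (b : ℕ)) (fun _ => a) (L.idxFun ⟨i - a, h⟩) else i - l + 1

theorem lineWord_of_ge {a l i : ℕ} (L : Combinatorics.Subspace Unit (Fin a) (Fin l))
    (h : a + l ≤ i) : lineWord L i = i - l + 1 := by
  unfold lineWord
  rw [if_neg (by omega), dif_neg (by omega)]

theorem lineWord_of_lt {a l i : ℕ} (L : Combinatorics.Subspace Unit (Fin a) (Fin l))
    (h : i < a) : lineWord L i = i := if_pos h

theorem lineWord_le {a l i : ℕ} (L : Combinatorics.Subspace Unit (Fin a) (Fin l))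
    (h : i < a + l) : lineWord L i ≤ a := by
  unfold lineWord
  split_ifs with h1 h2
  · omega
  · rcases L.idxFun ⟨i - a, h2⟩ with b | b
    · exact b.2.le
    · exact le_rfl
  · omega

theorem isParamWord_lineWord {a l : ℕ} (L : Combinatorics.Subspace Unit (Fin a) (Fin l)) :
    IsParamWord a l 1 (lineWord L) where
  growth i v hv := by
    by_cases hva : v < a
    · refine ⟨v, ?_, lineWord_of_lt L hva⟩
      by_contra hvi
      rw [lineWord_of_lt L (by omega)] at hv
      omega
    · have hi : a + l ≤ i := by
        by_contra h
        have := lineWord_le L (show i < a + l by omega)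
        omega
      rw [lineWord_of_ge L hi] at hv
      by_cases hva : v = a
      · obtain ⟨⟨t, ht⟩, htp⟩ := L.proper ()
        refine ⟨a + t, by omega, ?_⟩
        unfold lineWord
        rw [if_neg (by omega), dif_pos (by omega)]
        simp [htp, hva]
      · refine ⟨v - 1 + l, by omega, ?_⟩
        rw [lineWord_of_ge L (by omega)]
        omega
  fixed i hi := lineWord_of_lt L hi
  bound i hi := Nat.lt_succ_of_le (lineWord_le L hi)
  tail j := by rw [lineWord_of_ge L (by omega)]; omega

theorem letterWord_comp_lineWord {a l : ℕ} (L : Combinatorics.Subspace Unit (Fin a) (Fin l))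
    (b : Fin a) :
    letterWord (fun _ : Fin 1 => b) ∘ lineWord L = letterWord (L fun _ => b) := by
  funext i
  simp only [Function.comp_apply]
  by_cases h1 : i < a
  · rw [lineWord_of_lt L h1, letterWord_of_lt _ h1, letterWord_of_lt _ h1]
  by_cases h2 : i - a < l
  · have e1 : letterWord (L fun _ => b) i = L (fun _ => b) ⟨i - a, h2⟩ := by
      rw [letterWord, if_neg h1, dif_pos h2]
    rw [e1, lineWord, if_neg h1, dif_pos h2, Combinatorics.Subspace.coe_apply]
    rcases L.idxFun ⟨i - a, h2⟩ with c | c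
    · simp [letterWord]
    · simp [letterWord]
  · rw [lineWord_of_ge L (by omega), letterWord_of_ge _ (by omega), letterWord_of_ge _ (by omega)]
    omega

/-- Colourings of words without parameters, of arbitrary lengths: there is a parameter word for
which the colour of an instance of the part preceding a parameter does not depend on the
instance. -/
theorem exists_prefix_stable {a : ℕ} (ha : 0 < a) (m : ℕ) : ∀ (κ : Type) [Finite κ],
    ∃ M, ∀ D : ℕ → (ℕ → ℕ) → κ, (∀ N x x', (∀ i < a + N, x i = x' i) → D N x = D N x') →
      ∃ v, IsParamWord a M m v ∧ ∀ p < m, ∀ N, v (a + N) = a + p → (∀ i < a + N, v i < a + p) →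
        ∀ f f' : ℕ → ℕ, (∀ i < a, f i = i) → (∀ i < a + p, f i < a) →
          (∀ i < a, f' i = i) → (∀ i < a + p, f' i < a) → D N (f ∘ v) = D N (f' ∘ v) := by
  induction m with
  | zero =>
    intro κ _
    exact ⟨0, fun D _ => ⟨id, IsParamWord.refl _ _, fun p hp => absurd hp (Nat.not_lt_zero p)⟩⟩
  | succ m ih =>
    intro κ _
    obtain ⟨l, hl⟩ := Combinatorics.Subspace.exists_mono_in_high_dimension_fin
      (Fin a) (Fin m → κ) Unit
    obtain ⟨M, hM⟩ := ih ((Fin l → Fin a) → κ)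
    refine ⟨l + M, fun D hD => ?_⟩
    obtain ⟨v, hv, hvD⟩ := hM (fun N z y => D (l + N) (z ∘ letterWord y)) (by
      intro N x x' hx
      funext y
      refine hD _ _ _ fun i hi => hx _ ?_
      by_cases h : i < a + l
      · have := letterWord_lt y h
        omega
      · rw [letterWord_of_ge y (by omega)]
        omega)
    choose! P hPM hP hPlt using fun p (hp : p < m) => hv.exists_first hp
    let f₀ : ℕ → ℕ := fun i => if i < a then i else 0
    have hf₀ : ∀ i < a, f₀ i = i := fun i hi => if_pos hi
    have hf₀a : ∀ i, f₀ i < a := fun i => by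
      simp only [f₀]
      split_ifs <;> omega
    obtain ⟨L, c, hL⟩ := hl fun y p => D (l + P p) (f₀ ∘ v ∘ letterWord y)
    have key : ∀ p < m, ∀ f : ℕ → ℕ, (∀ i < a, f i = i) → (∀ i < a + (p + 1), f i < a) →
        ∃ b, D (l + P p) (f ∘ shiftWord a 1 v ∘ lineWord L) =
          D (l + P p) (f₀ ∘ v ∘ letterWord (L fun _ => b)) := by
      intro p hp f hf hfa
      let b : Fin a := ⟨f a, hfa a (by omega)⟩
      let f₂ : ℕ → ℕ := fun i => if i < a then i else f (i + 1)
      have e : f = f₂ ∘ letterWord (fun _ : Fin 1 => b) := by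
        funext i
        simp only [Function.comp_apply]
        by_cases h1 : i < a
        · rw [letterWord_of_lt _ h1, hf i h1]
          exact (if_pos h1).symm
        · by_cases h2 : i = a
          · subst h2
            have : letterWord (fun _ : Fin 1 => b) i = f i := by simp [letterWord, b]
            rw [this]
            exact (if_pos (hfa i (by omega))).symm
          · rw [letterWord_of_ge _ (by omega)]
            simp only [f₂]
            rw [if_neg (by omega), Nat.sub_add_cancel (by omega)]
      have e2 : f ∘ shiftWord a 1 v ∘ lineWord L = f₂ ∘ v ∘ letterWord (L fun _ => b) := by
        rw [e, Function.comp_assoc, ← Function.comp_assoc (letterWord _),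
          letterWord_comp_shiftWord _ hv.fixed, Function.comp_assoc, letterWord_comp_lineWord]
      refine ⟨b, ?_⟩
      rw [e2]
      refine congrFun (hvD p hp (P p) (hP p hp) (hPlt p hp) f₂ f₀ (fun i hi => if_pos hi)
        (fun i hi => ?_) hf₀ (fun i _ => hf₀a i)) _
      simp only [f₂]
      split_ifs with h
      · exact h
      · exact hfa _ (by omega)
    have hw : IsParamWord a (l + M) (m + 1) (shiftWord a 1 v ∘ lineWord L) := by
      have h1 := (isParamWord_lineWord L).extend M
      have h2 := hv.shiftWord 1
      rw [Nat.add_comm 1 m] at h2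
      exact h2.comp h1
    refine ⟨_, hw, fun p hp N hN hlt f f' hf hfa hf' hfa' => ?_⟩
    rcases p with _ | p
    · refine hD _ _ _ fun i hi => ?_
      have := hlt i hi
      simp only [Function.comp_apply] at this ⊢
      rw [hf _ (by omega), hf' _ (by omega)]
    · have hp : p < m := by omega
      have hNP : N = l + P p := by
        have h1 : (shiftWord a 1 v ∘ lineWord L) (a + (l + P p)) = a + (p + 1) := by
          simp only [Function.comp_apply]
          rw [lineWord_of_ge L (by omega), shiftWord, if_neg (by omega),
            show a + (l + P p) - l + 1 - 1 = a + P p by omega, hP p hp, if_neg (by omega)]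
          omega
        have h2 : ∀ i < a + (l + P p), (shiftWord a 1 v ∘ lineWord L) i < a + (p + 1) := by
          intro i hi
          simp only [Function.comp_apply]
          by_cases h : i < a + l
          · have := lineWord_le L h
            rw [shiftWord_of_lt v (by omega)]
            omega
          · rw [lineWord_of_ge L (by omega), shiftWord]
            have := hPlt p hp (i - l) (by omega)
            rw [Nat.add_sub_cancel]
            split_ifs <;> omega
        rcases lt_trichotomy N (l + P p) with h | h | h
        · have := h2 (a + N) (by omega)
          omega
        · exact h
        · have := hlt (a + (l + P p)) (by omega)
          omega
      subst hNP
      obtain ⟨b, hb⟩ := key p hp f hf hfa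
      obtain ⟨b', hb'⟩ := key p hp f' hf' hfa'
      rw [hb, hb']
      exact (congrFun (hL fun _ => b) ⟨p, hp⟩).trans (congrFun (hL fun _ => b') ⟨p, hp⟩).symm

/-- The Graham–Rothschild property for `k`-parameter words over an alphabet of `a` letters. -/
def GrahamRothschild (a k : ℕ) : Prop :=
  ∀ (κ : Type) [Finite κ] (m : ℕ), ∃ n, ∀ χ : (ℕ → ℕ) → κ, ∃ w, IsParamWord a n m w ∧
    ∃ c, ∀ f, IsParamWord a m k f → χ (f ∘ w) = c

theorem grahamRothschild_zero {a : ℕ} (ha : 0 < a) : GrahamRothschild a 0 := by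
  intro κ _ m
  obtain ⟨M, hM⟩ := exists_prefix_stable ha (m + 1) κ
  refine ⟨M, fun χ => ?_⟩
  obtain ⟨v, hv, hvD⟩ := hM (fun N x => χ fun i =>
      if i < a + N then x i else if i < a + M then 0 else i - M) (by
    intro N x x' hx
    refine congrArg χ (funext fun i => ?_)
    split_ifs with h
    · exact hx i h
    · rfl
    · rfl)
  obtain ⟨N, hNM, hN, hlt⟩ := hv.exists_first (Nat.lt_succ_self m)
  let w : ℕ → ℕ := fun i => if i < a + N then v i else if i < a + M then 0 else i - M + m
  have hw1 : ∀ i < a + N, w i = v i := fun i hi => if_pos hi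
  have hw2 : ∀ i, a + N ≤ i → i < a + M → w i = 0 := fun i h1 h2 => by
    simp only [w]
    rw [if_neg (by omega), if_pos h2]
  have hw3 : ∀ i, a + M ≤ i → w i = i - M + m := fun i h1 => by
    simp only [w]
    rw [if_neg (by omega), if_neg (by omega)]
  have hwp : IsParamWord a M m w := by
    refine ⟨fun i u hu => ?_, fun i hi => ?_, fun i hi => ?_, fun j => ?_⟩
    · rcases Nat.lt_or_ge i (a + N) with h1 | h1
      · rw [hw1 i h1] at hu
        obtain ⟨j, hj, hju⟩ := hv.growth i u hu
        exact ⟨j, hj, by rw [hw1 j (by omega), hju]⟩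
      rcases Nat.lt_or_ge i (a + M) with h2 | h2
      · rw [hw2 i h1 h2] at hu
        omega
      · rw [hw3 i h2] at hu
        rcases Nat.lt_or_ge u (a + m) with h3 | h3
        · obtain ⟨j, hj, hju⟩ := hv.growth (a + N) u (by omega)
          exact ⟨j, by omega, by rw [hw1 j hj, hju]⟩
        · exact ⟨u - m + M, by omega, by rw [hw3 _ (by omega)]; omega⟩
    · rw [hw1 i (by omega), hv.fixed i hi]
    · rcases Nat.lt_or_ge i (a + N) with h1 | h1
      · rw [hw1 i h1]
        exact hlt i h1
      · rw [hw2 i h1 hi]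
        omega
    · rw [hw3 _ (by omega)]
      omega
  have hpad : ∀ f : ℕ → ℕ, IsParamWord a m 0 f → χ (f ∘ w) = χ (fun i =>
      if i < a + N then (f ∘ v) i else if i < a + M then 0 else i - M) := by
    intro f hf
    refine congrArg χ (funext fun i => ?_)
    simp only [Function.comp_apply]
    rcases Nat.lt_or_ge i (a + N) with h1 | h1
    · rw [hw1 i h1, if_pos h1]
    rcases Nat.lt_or_ge i (a + M) with h2 | h2
    · rw [hw2 i h1 h2, if_neg (by omega), if_pos h2, hf.fixed 0 ha]
    · rw [hw3 i h2, if_neg (by omega), if_neg (by omega)]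
      have := hf.tail (i - M - a)
      rw [show a + m + (i - M - a) = i - M + m by omega] at this
      omega
  have hf₀ := isParamWord_letterWord fun _ : Fin m => (⟨0, ha⟩ : Fin a)
  refine ⟨w, hwp, χ (letterWord (fun _ : Fin m => (⟨0, ha⟩ : Fin a)) ∘ w), fun f hf => ?_⟩
  rw [hpad f hf, hpad _ hf₀]
  exact hvD m (Nat.lt_succ_self m) N hN hlt f _ hf.fixed (fun i hi => hf.bound i hi)
    hf₀.fixed (fun i hi => hf₀.bound i hi)

/-- Fusion: the colour of an instance can be made to depend only on its part preceding the first
occurrence of the first parameter, as long as this part is shorter than `p`. -/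
theorem GrahamRothschild.exists_fusion {a k : ℕ} (h : GrahamRothschild (a + 1) k) (κ : Type)
    [Finite κ] (p : ℕ) : ∀ r, ∃ n, ∀ χ : (ℕ → ℕ) → κ, ∃ w, IsParamWord a n (p + r) w ∧
      ∀ q < p, ∀ f f', IsParamWord a (p + r) (k + 1) f → IsParamWord a (p + r) (k + 1) f' →
        (∀ i < a + q, f i = f' i ∧ f i < a) → f (a + q) = a → f' (a + q) = a →
          χ (f ∘ w) = χ (f' ∘ w) := by
  induction p with
  | zero => exact fun r => ⟨0 + r, fun χ => ⟨id, IsParamWord.refl _ _, fun q hq => by omega⟩⟩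
  | succ p ih =>
    intro r
    obtain ⟨s, hs⟩ := h ((Fin p → Fin a) → κ) r
    obtain ⟨n, hn⟩ := ih (s + 1)
    refine ⟨n, fun χ => ?_⟩
    obtain ⟨w, hw, hgood⟩ := hn χ
    obtain ⟨v, hv, c, hc⟩ := hs fun g y => χ (g ∘ letterWord y ∘ w)
    have hv' := hv.of_succ.shiftWord p
    have hvfix : ∀ i < a + (p + 1), shiftWord a p v i = i := by
      intro i hi
      by_cases h1 : i < a + p
      · exact shiftWord_of_lt v h1
      · rw [shiftWord, if_neg h1, show i - p = a by omega, hv.fixed a (by omega),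
          if_neg (by omega)]
        omega
    rw [show p + 1 + r = p + (r + 1) by omega]
    refine ⟨_, hv'.comp hw, fun q hq f f' hf hf' hff hfq hfq' => ?_⟩
    rcases Nat.lt_or_ge q p with hqp | hqp
    · refine hgood q hqp _ _ (hf.comp hv') (hf'.comp hv') ?_ ?_ ?_
      · intro i hi
        simp only [Function.comp_apply]
        rw [hvfix i (by omega)]
        exact hff i hi
      · simpa only [Function.comp_apply, hvfix (a + q) (by omega)] using hfq
      · simpa only [Function.comp_apply, hvfix (a + q) (by omega)] using hfq'
    · obtain rfl : q = p := by omega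
      let y : Fin q → Fin a := fun i => ⟨f (a + i), (hff (a + i) (by omega)).2⟩
      have key : ∀ F, IsParamWord a (q + (r + 1)) (k + 1) F → (∀ i < a + q, F i = f i) →
          F (a + q) = a → χ (F ∘ shiftWord a q v ∘ w) = c y := by
        intro F hF hFf hFq
        let g : ℕ → ℕ := fun i => if i < a then i else F (i + q)
        have hga : ∀ i, a ≤ i → g i = F (i + q) := fun i hi => if_neg (by omega)
        have hgl : ∀ i < a, g i = i := fun i hi => if_pos hi
        have hFg : F = g ∘ letterWord y := by
          funext i
          simp only [Function.comp_apply]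
          rcases Nat.lt_or_ge i (a + q) with h1 | h1
          · rw [hgl _ (letterWord_lt y h1), hFf i h1, letterWord]
            split_ifs with h2 h3
            · rw [← hFf i h1, hF.fixed i h2]
            · simp only [y]
              rw [show a + (i - a) = i by omega]
            · omega
          · rw [letterWord_of_ge y h1, hga _ (by omega), Nat.sub_add_cancel (by omega)]
        have hg : IsParamWord (a + 1) r k g := by
          refine ⟨fun i u hu => ?_, fun i hi => ?_, fun i hi => ?_, fun j => ?_⟩
          · rcases Nat.lt_or_ge i a with h1 | h1
            · rw [hgl i h1] at hu
              exact ⟨u, hu, hgl u (by omega)⟩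
            · rcases Nat.lt_or_ge u a with h2 | h2
              · exact ⟨u, by omega, hgl u h2⟩
              · rw [hga i h1] at hu
                obtain ⟨j, hj, hju⟩ := hF.growth _ _ hu
                have hjq : a + q ≤ j := by
                  by_contra h3
                  have := hFf j (by omega)
                  have := (hff j (by omega)).2
                  omega
                exact ⟨j - q, by omega, by
                  rw [hga _ (by omega), Nat.sub_add_cancel (by omega), hju]⟩
          · rcases Nat.lt_or_ge i a with h1 | h1
            · exact hgl i h1
            · obtain rfl : i = a := by omega
              rw [hga i h1, hFq]
          · rcases Nat.lt_or_ge i a with h1 | h1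
            · rw [hgl i h1]
              omega
            · rw [hga i h1]
              have := hF.bound (i + q) (by omega)
              omega
          · rw [hga _ (by omega)]
            have := hF.tail j
            rw [show a + 1 + r + j + q = a + (q + (r + 1)) + j by omega, this]
            omega
        have e : F ∘ shiftWord a q v ∘ w = g ∘ v ∘ letterWord y ∘ w := by
          rw [hFg, Function.comp_assoc, ← Function.comp_assoc (letterWord y),
            letterWord_comp_shiftWord y fun i hi => hv.fixed i (by omega), Function.comp_assoc]
        rw [e]
        exact congrFun (hc g hg) y
      rw [key f hf (fun _ _ => rfl) hfq, key f' hf' (fun i hi => (hff i hi).1.symm) hfq']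

/-- There is a parameter word whose parameters first occur at prescribed positions. -/
theorem exists_paramWord_first_eq {a : ℕ} (ha : 0 < a) {m M : ℕ} {P : Fin m → ℕ}
    (hP : StrictMono P) (hPM : ∀ s, P s < M) :
    ∃ u, IsParamWord a M m u ∧ ∀ p, u (a + P p) = a + p ∧ ∀ i < a + P p, u i < a + p := by
  let c : ℕ → ℕ := fun i => (Finset.univ.filter fun s => P s ≤ i).card
  have hc_eq : ∀ t, c (P t) = t + 1 := by
    intro t
    have : (Finset.univ.filter fun s => P s ≤ P t) = Finset.Iic t := by
      ext s
      simp [hP.le_iff_le]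
    simp only [c, this, Fin.card_Iic]
  have hc_lt : ∀ t, ∀ i < P t, c i ≤ t := by
    intro t i hi
    have : (Finset.univ.filter fun s => P s ≤ i) ⊆ Finset.Iio t := by
      intro s hs
      simp only [Finset.mem_filter, Finset.mem_univ, true_and] at hs
      exact Finset.mem_Iio.2 (hP.lt_iff_lt.1 (by omega))
    simpa using Finset.card_le_card this
  have hc_le : ∀ i, c i ≤ m := fun i => by
    simpa using Finset.card_le_univ (Finset.univ.filter fun s => P s ≤ i)
  let u : ℕ → ℕ := fun i => if i < a then i else if i < a + M then
    (if c (i - a) = 0 then 0 else a + c (i - a) - 1) else i - M + m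
  have hu1 : ∀ i < a, u i = i := fun i hi => if_pos hi
  have hu2 : ∀ i, a ≤ i → i < a + M → u i = if c (i - a) = 0 then 0 else a + c (i - a) - 1 := by
    intro i h1 h2
    simp only [u]
    rw [if_neg (by omega), if_pos h2]
  have hu3 : ∀ i, a + M ≤ i → u i = i - M + m := by
    intro i h1
    simp only [u]
    rw [if_neg (by omega), if_neg (by omega)]
  have hfirst : ∀ t, u (a + P t) = a + t := by
    intro t
    rw [hu2 _ (by omega) (by have := hPM t; omega), Nat.add_sub_cancel_left, hc_eq,
      if_neg (by omega)]
    omega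
  refine ⟨u, ⟨fun i v hv => ?_, hu1, fun i hi => ?_, fun j => ?_⟩, fun p => ⟨hfirst p, ?_⟩⟩
  · rcases Nat.lt_or_ge i a with h1 | h1
    · rw [hu1 i h1] at hv
      exact ⟨v, hv, hu1 v (by omega)⟩
    rcases Nat.lt_or_ge v a with h2 | h2
    · exact ⟨v, by omega, hu1 v h2⟩
    rcases Nat.lt_or_ge i (a + M) with h3 | h3
    · rw [hu2 i h1 h3] at hv
      have hci := hc_le (i - a)
      split_ifs at hv
      · omega
      have hvm : v - a < m := by omega
      refine ⟨a + P ⟨v - a, hvm⟩, ?_, by rw [hfirst]; simp only; omega⟩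
      by_contra h4
      rcases Nat.lt_or_ge (i - a) (P ⟨v - a, hvm⟩) with h5 | h5
      · have := hc_lt _ _ h5
        simp only at this
        omega
      · have h6 := hc_eq ⟨v - a, hvm⟩
        rw [show P ⟨v - a, hvm⟩ = i - a by omega] at h6
        simp only at h6
        omega
    · rw [hu3 i h3] at hv
      rcases Nat.lt_or_ge v (a + m) with h4 | h4
      · have := hPM ⟨v - a, by omega⟩
        exact ⟨a + P ⟨v - a, by omega⟩, by omega, by rw [hfirst]; simp only; omega⟩
      · exact ⟨v - m + M, by omega, by rw [hu3 _ (by omega)]; omega⟩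
  · rcases Nat.lt_or_ge i a with h1 | h1
    · rw [hu1 i h1]
      omega
    · rw [hu2 i h1 hi]
      have := hc_le (i - a)
      split_ifs <;> omega
  · rw [hu3 _ (by omega)]
    omega
  · intro i hi
    have := hPM p
    rcases Nat.lt_or_ge i a with h1 | h1
    · rw [hu1 i h1]
      omega
    · rw [hu2 i h1 (by omega)]
      have := hc_lt p (i - a) (by omega)
      split_ifs <;> omega

theorem GrahamRothschild.succ {a k : ℕ} (ha : 0 < a) (h : GrahamRothschild (a + 1) k) :
    GrahamRothschild a (k + 1) := by
  intro κ _ m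
  have := Fintype.ofFinite κ
  obtain ⟨M, hM⟩ := exists_prefix_stable ha (Fintype.card κ * m + 1) κ
  obtain ⟨n, hn⟩ := h.exists_fusion κ M 0
  refine ⟨n, fun χ => ?_⟩
  obtain ⟨w, hw, hgood⟩ := hn χ
  rw [Nat.add_zero] at hw hgood
  let Q : ℕ → (ℕ → ℕ) → (ℕ → ℕ) → Prop := fun N x F =>
    IsParamWord a M (k + 1) F ∧ (∀ i < a + N, F i = x i ∧ F i < a) ∧ F (a + N) = a
  have hQ : ∀ N < M, ∀ F, Q N F F → χ (Classical.epsilon (Q N F) ∘ w) = χ (F ∘ w) := by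
    intro N hN F hF
    obtain ⟨h1, h2, h3⟩ := Classical.epsilon_spec (p := Q N F) ⟨F, hF⟩
    exact hgood N hN _ _ h1 hF.1 h2 h3 hF.2.2
  obtain ⟨v, hv, hvD⟩ := hM (fun N x => χ (Classical.epsilon (Q N x) ∘ w)) (by
    intro N x x' hx
    have : Q N x = Q N x' := by
      funext F
      refine propext (and_congr_right fun _ => and_congr_left fun _ => ?_)
      exact forall₂_congr fun i hi => by rw [hx i hi]
    simp only [this])
  choose! N hNM hN hNlt using fun p (hp : p < Fintype.card κ * m + 1) => hv.exists_first hp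
  let f₀ : ℕ → ℕ := fun i => if i < a then i else 0
  have hf₀ : ∀ i < a, f₀ i = i := fun i hi => if_pos hi
  have hf₀a : ∀ i, f₀ i < a := fun i => by
    simp only [f₀]
    split_ifs <;> omega
  obtain ⟨c, -, hc⟩ := Finset.exists_lt_card_fiber_of_mul_lt_card_of_maps_to
    (s := Finset.range (Fintype.card κ * m + 1)) (t := (Finset.univ : Finset κ)) (n := m)
    (f := fun p => χ (Classical.epsilon (Q (N p) (f₀ ∘ v)) ∘ w)) (fun _ _ => Finset.mem_univ _)
    (by simp)
  let P := Finset.orderEmbOfCardLe _ hc.le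
  have hPS : ∀ s, P s < Fintype.card κ * m + 1 ∧
      χ (Classical.epsilon (Q (N (P s)) (f₀ ∘ v)) ∘ w) = c := by
    intro s
    simpa using Finset.orderEmbOfCardLe_mem _ hc.le s
  obtain ⟨u, hu, huP⟩ := exists_paramWord_first_eq ha P.strictMono fun s => (hPS s).1
  refine ⟨u ∘ v ∘ w, hu.comp (hv.comp hw), c, fun f hf => ?_⟩
  obtain ⟨p, hpm, hp, hplt⟩ := hf.exists_first (Nat.succ_pos k)
  rw [Nat.add_zero] at hp hplt
  obtain ⟨huP1, huP2⟩ := huP ⟨p, hpm⟩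
  obtain ⟨hP1, hP2⟩ := hPS ⟨p, hpm⟩
  have hlt : ∀ i < a + P ⟨p, hpm⟩, (f ∘ u) i < a := fun i hi => hplt _ (huP2 i hi)
  rw [← hP2, ← hvD _ hP1 _ (hN _ hP1) (hNlt _ hP1) (f ∘ u) f₀ (hf.comp hu).fixed hlt hf₀
    fun i _ => hf₀a i]
  refine (hQ _ (hNM _ hP1) _ ⟨(hf.comp hu).comp hv, fun i hi => ⟨rfl, ?_⟩, ?_⟩).symm
  · exact hlt _ (hNlt _ hP1 i hi)
  · simp only [Function.comp_apply]
    rw [hN _ hP1, huP1]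
    exact hp

theorem grahamRothschild (k : ℕ) : ∀ {a : ℕ}, 0 < a → GrahamRothschild a k := by
  induction k with
  | zero => exact grahamRothschild_zero
  | succ k ih => exact fun ha => GrahamRothschild.succ ha (ih (Nat.succ_pos _))

/-- Rigid surjections, described by restricted growth: `f` is onto, and every element below a
value of `f` is attained earlier. -/
def IsRigid {A B : Type*} [LinearOrder A] [LinearOrder B] (f : A → B) : Prop :=
  Function.Surjective f ∧ ∀ i, ∀ v < f i, ∃ j < i, f j = v

/-- The dual Ramsey theorem for finite chains and rigid surjections. -/
theorem exists_isRigid_monochromatic (A B κ : Type) [Fintype A] [LinearOrder A] [Nonempty A]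
    [Fintype B] [LinearOrder B] [Nonempty B] [Finite κ] :
    ∃ n, ∀ χ : (Fin n → A) → κ, ∃ u : Fin n → B, IsRigid u ∧
      ∃ c, ∀ g : B → A, IsRigid g → χ (g ∘ u) = c := by
  obtain ⟨k, hk⟩ : ∃ k, Fintype.card A = 1 + k :=
    ⟨Fintype.card A - 1, by have := Fintype.card_pos (α := A); omega⟩
  obtain ⟨m, hm⟩ : ∃ m, Fintype.card B = 1 + m :=
    ⟨Fintype.card B - 1, by have := Fintype.card_pos (α := B); omega⟩
  let eA : Fin (1 + k) ≃o A := Fintype.orderIsoFinOfCardEq A hk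
  let eB : Fin (1 + m) ≃o B := Fintype.orderIsoFinOfCardEq B hm
  obtain ⟨n, hn⟩ := grahamRothschild k Nat.one_pos κ m
  let tA : ℕ → A := fun i => if h : i < 1 + k then eA ⟨i, h⟩ else Classical.arbitrary A
  refine ⟨1 + n, fun χ => ?_⟩
  obtain ⟨w, hw, c, hc⟩ := hn fun f => χ fun i => tA (f i)
  refine ⟨fun i => eB ⟨w i, hw.bound i i.2⟩, ⟨fun b => ?_, fun i v hv => ?_⟩, c, fun g hg => ?_⟩
  · obtain ⟨i, hi, hib⟩ := hw.growth (1 + n) (eB.symm b) (by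
      have := hw.tail 0
      have := (eB.symm b).2
      simp only [Nat.add_zero] at *
      omega)
    exact ⟨⟨i, hi⟩, by simp [hib]⟩
  · obtain ⟨j, hj, hjv⟩ := hw.growth i (eB.symm v) (by
      have : eB.symm v < _ := eB.symm.lt_iff_lt.2 hv
      simpa [Fin.lt_def] using this)
    exact ⟨⟨j, hj.trans i.2⟩, hj, by simp [hjv]⟩
  · let h : ℕ → ℕ := fun i => if hi : i < 1 + m then eA.symm (g (eB ⟨i, hi⟩)) else i - m + k
    have h1 : ∀ i (hi : i < 1 + m), h i = eA.symm (g (eB ⟨i, hi⟩)) := fun i hi => dif_pos hi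
    have h2 : ∀ i, 1 + m ≤ i → h i = i - m + k := fun i hi => dif_neg (by omega)
    have hh : IsParamWord 1 m k h := by
      have hgrow : RestrictedGrowth h := by
        intro i v hv
        by_cases hi : i < 1 + m
        · rw [h1 i hi] at hv
          obtain ⟨j, hj, hjv⟩ := hg.2 _ (eA ⟨v, hv.trans (Fin.is_lt _)⟩) (by
            rw [← eA.lt_symm_apply]
            exact hv)
          have hj' : eB.symm j < ⟨i, hi⟩ := by rwa [eB.symm_apply_lt]
          refine ⟨eB.symm j, hj', ?_⟩
          rw [h1 _ (Fin.is_lt _)]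
          simp [hjv]
        · rw [h2 i (by omega)] at hv
          by_cases hv' : v < 1 + k
          · obtain ⟨j, hj⟩ := hg.1 (eA ⟨v, hv'⟩)
            refine ⟨eB.symm j, by have := (eB.symm j).2; omega, ?_⟩
            rw [h1 _ (Fin.is_lt _)]
            simp [hj]
          · exact ⟨v - k + m, by omega, by rw [h2 _ (by omega)]; omega⟩
      refine ⟨hgrow, fun i hi => ?_, fun i hi => ?_, fun j => ?_⟩
      · obtain rfl : i = 0 := by omega
        by_contra h0
        obtain ⟨j, hj, -⟩ := hgrow 0 0 (by omega)
        omega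
      · rw [h1 i hi]
        exact Fin.is_lt _
      · rw [h2 _ (by omega)]
        omega
    rw [← hc h hh]
    refine congrArg χ (funext fun i => ?_)
    have hb := hw.bound i i.2
    simp only [Function.comp_apply, tA]
    rw [dif_pos (by rw [h1 _ hb]; exact Fin.is_lt _)]
    simp [h1 _ hb]

section Tuples

variable {A B : Type*} [LinearOrder A] [LinearOrder B]

theorem altLex_iff_toColex_lt {X Y : Finset A} : altLex X Y ↔ toColex X < toColex Y := by
  rw [Finset.Colex.lt_iff_exists_filter_lt]
  refine exists_congr fun m => ?_
  simp only [Finset.mem_sdiff, Finset.ext_iff, Finset.mem_filter, and_assoc]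
  refine and_congr_right fun _ => and_congr_right fun _ => forall_congr' fun z => ?_
  constructor
  · exact fun h => ⟨fun h1 => ⟨(h h1.2).1 h1.1, h1.2⟩, fun h1 => ⟨(h h1.2).2 h1.1, h1.2⟩⟩
  · exact fun h hz => ⟨fun h1 => (h.1 ⟨h1, hz⟩).1, fun h1 => (h.2 ⟨h1, hz⟩).1⟩

theorem altLex_irrefl (X : Finset A) : ¬ altLex X X := by
  rw [altLex_iff_toColex_lt]
  exact lt_irrefl _

theorem altLex.trans {X Y Z : Finset A} (h : altLex X Y) (h' : altLex Y Z) : altLex X Z := by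
  rw [altLex_iff_toColex_lt] at *
  exact h.trans h'

theorem altLex_of_forall_lt {X Y : Finset A} (hY : Y.Nonempty) (h : ∀ x ∈ X, ∀ y ∈ Y, x < y) :
    altLex X Y := by
  refine ⟨Y.max' hY, Y.max'_mem hY, fun hX => lt_irrefl _ (h _ hX _ (Y.max'_mem hY)),
    fun z hz => iff_of_false (fun hX => ?_) fun hZ => ?_⟩
  · exact lt_asymm hz (h _ hX _ (Y.max'_mem hY))
  · exact (Y.le_max' z hZ).not_gt hz

theorem altLex_singleton {a b : A} : altLex {a} {b} ↔ a < b := by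
  rw [altLex_iff_toColex_lt, Finset.Colex.singleton_lt_singleton]

theorem quasiLT_irrefl (n : ℕ) (σ : ℕ → ℕ → Prop) : ¬ quasiLT n σ σ := by
  rintro (h | ⟨-, M, h, h', -⟩)
  · exact lt_irrefl _ h
  · exact h' h

theorem quasiLT.card_le {n : ℕ} {σ τ : ℕ → ℕ → Prop} (h : quasiLT n σ τ) :
    (classesOf σ n).card ≤ (classesOf τ n).card := by
  rcases h with h | ⟨h, -⟩
  · exact h.le
  · exact h.le

theorem card_image_eq_card_image {ι α β : Type*} [DecidableEq α] [DecidableEq β] {I : Finset ι}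
    {f : ι → α} {g : ι → β} (h : ∀ i ∈ I, ∀ j ∈ I, f i = f j ↔ g i = g j) :
    (I.image f).card = (I.image g).card := by
  have hf : (I.image fun i => (f i, g i)).card = (I.image f).card := by
    have : I.image f = (I.image fun i => (f i, g i)).image Prod.fst := by
      rw [Finset.image_image]; rfl
    rw [this]
    refine (Finset.card_image_of_injOn fun x hx y hy hxy => ?_).symm
    obtain ⟨i, hi, rfl⟩ := Finset.mem_image.1 hx
    obtain ⟨j, hj, rfl⟩ := Finset.mem_image.1 hy
    exact Prod.ext hxy ((h i hi j hj).1 hxy)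
  have hg : (I.image fun i => (f i, g i)).card = (I.image g).card := by
    have : I.image g = (I.image fun i => (f i, g i)).image Prod.snd := by
      rw [Finset.image_image]; rfl
    rw [this]
    refine (Finset.card_image_of_injOn fun x hx y hy hxy => ?_).symm
    obtain ⟨i, hi, rfl⟩ := Finset.mem_image.1 hx
    obtain ⟨j, hj, rfl⟩ := Finset.mem_image.1 hy
    exact Prod.ext ((h i hi j hj).2 hxy) hxy
  rw [← hf, hg]

theorem tpRel_iff {l : List A} {i j : ℕ} (hi : i < l.length) (hj : j < l.length) :
    tpRel l i j ↔ l[i] ≤ l[j] :=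
  ⟨fun ⟨_, _, h⟩ => h, fun h => ⟨hi, hj, h⟩⟩

theorem length_eq_of_tpRel_eq {l : List A} {l' : List B} (h : tpRel l = tpRel l') :
    l.length = l'.length := by
  have key : ∀ i, i < l.length ↔ i < l'.length := by
    intro i
    have := congrFun (congrFun h i) i
    constructor
    · intro hi
      exact (this.mp ⟨hi, hi, le_rfl⟩).1
    · intro hi
      exact (this.mpr ⟨hi, hi, le_rfl⟩).1
  have h1 := key l.length
  have h2 := key l'.length
  omega

theorem getElem_le_iff_of_tpRel_eq {l : List A} {l' : List B} (h : tpRel l = tpRel l') {i j : ℕ}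
    (hi : i < l.length) (hj : j < l.length) (hi' : i < l'.length) (hj' : j < l'.length) :
    l[i] ≤ l[j] ↔ l'[i] ≤ l'[j] := by
  rw [← tpRel_iff hi hj, ← tpRel_iff hi' hj', h]

theorem tpRel_map {l : List A} {f : A → B} (hf : ∀ x ∈ l, ∀ y ∈ l, x < y → f x < f y) :
    tpRel (l.map f) = tpRel l := by
  have hf' : ∀ x ∈ l, ∀ y ∈ l, f x ≤ f y ↔ x ≤ y := by
    intro x hx y hy
    refine ⟨fun h => le_of_not_gt fun hlt => (hf y hy x hx hlt).not_ge h, fun h => ?_⟩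
    rcases h.eq_or_lt with rfl | h
    · exact le_rfl
    · exact (hf x hx y hy h).le
  funext i j
  refine propext ⟨?_, ?_⟩
  · rintro ⟨hi, hj, h⟩
    rw [List.length_map] at hi hj
    refine ⟨hi, hj, ?_⟩
    simp only [List.get_eq_getElem, List.getElem_map] at h
    exact (hf' _ (List.getElem_mem _) _ (List.getElem_mem _)).1 h
  · rintro ⟨hi, hj, h⟩
    refine ⟨by simpa using hi, by simpa using hj, ?_⟩
    simp only [List.get_eq_getElem, List.getElem_map]
    exact (hf' _ (List.getElem_mem _) _ (List.getElem_mem _)).2 h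

/-- The entries of a list as an image of the set of positions. -/
theorem toFinset_eq_image_get (l : List A) :
    l.toFinset = (Finset.univ : Finset (Fin l.length)).image l.get := by
  ext x
  simp [List.mem_iff_get]

theorem card_classesOf_tpRel (l : List A) :
    (classesOf (tpRel l) l.length).card = l.toFinset.card := by
  have h1 : classesOf (tpRel l) l.length =
      (Finset.univ : Finset (Fin l.length)).image
        fun i : Fin l.length => classOf (tpRel l) l.length i := by
    ext x
    simp only [classesOf, Finset.mem_image, Finset.mem_range, Finset.mem_univ, true_and]
    exact ⟨fun ⟨i, hi, h⟩ => ⟨⟨i, hi⟩, h⟩, fun ⟨i, h⟩ => ⟨i, i.2, h⟩⟩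
  rw [h1, toFinset_eq_image_get]
  refine card_image_eq_card_image fun i _ j _ => ?_
  have mem : ∀ i j : Fin l.length, (j : ℕ) ∈ classOf (tpRel l) l.length i ↔ l.get i = l.get j := by
    intro i j
    simp only [classOf, Finset.mem_filter, Finset.mem_range, j.2, true_and,
      tpRel_iff i.2 j.2, tpRel_iff j.2 i.2]
    exact le_antisymm_iff.symm
  constructor
  · intro h
    rw [← mem, h, mem]
  · intro h
    ext x
    by_cases hx : x < l.length
    · rw [mem i ⟨x, hx⟩, mem j ⟨x, hx⟩, h]
    · simp [classOf, hx]

theorem card_toFinset_eq_of_tpRel_eq {l : List A} {l' : List B} (h : tpRel l = tpRel l') :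
    l.toFinset.card = l'.toFinset.card := by
  rw [← card_classesOf_tpRel, ← card_classesOf_tpRel, h, length_eq_of_tpRel_eq h]

theorem salLT.card_le {l l' : List A} (h : salLT l l') : l.toFinset.card ≤ l'.toFinset.card := by
  obtain ⟨hlen, h | ⟨h, -⟩⟩ := h
  · rw [← card_classesOf_tpRel, ← card_classesOf_tpRel, ← hlen]
    exact h.card_le
  · exact (card_toFinset_eq_of_tpRel_eq h).le

theorem salLT_of_card_lt {l l' : List A} (hlen : l.length = l'.length)
    (h : l.toFinset.card < l'.toFinset.card) : salLT l l' := by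
  rw [← card_classesOf_tpRel, ← card_classesOf_tpRel, ← hlen] at h
  exact ⟨hlen, Or.inl (Or.inl h)⟩

theorem salLT_iff_altLex {l l' : List A} (h : tpRel l = tpRel l') :
    salLT l l' ↔ altLex l.toFinset l'.toFinset := by
  refine ⟨?_, fun h' => ⟨length_eq_of_tpRel_eq h, Or.inr ⟨h, fun he => ?_, h'⟩⟩⟩
  · rintro ⟨-, h' | ⟨-, -, h'⟩⟩
    · rw [h] at h'
      exact absurd h' (quasiLT_irrefl _ _)
    · exact h'
  · rw [he] at h'
    exact altLex_irrefl _ h'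

theorem tpRel_replicate (r : ℕ) (a : A) (b : B) :
    tpRel (List.replicate r a) = tpRel (List.replicate r b) := by
  funext i j
  simp [tpRel]

theorem salLT_replicate {r : ℕ} (hr : r ≠ 0) {a b : A} :
    salLT (List.replicate r a) (List.replicate r b) ↔ a < b := by
  rw [salLT_iff_altLex (tpRel_replicate r a b), List.toFinset_replicate_of_ne_zero hr,
    List.toFinset_replicate_of_ne_zero hr, altLex_singleton]

theorem exists_eq_replicate {l : List A} (hl : l ≠ []) (h : ¬ 1 < l.toFinset.card) :
    ∃ a ∈ l, l = List.replicate l.length a := by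
  obtain ⟨a, ha⟩ := List.exists_mem_of_ne_nil l hl
  refine ⟨a, ha, List.eq_replicate_iff.2 ⟨rfl, fun b hb => ?_⟩⟩
  exact Finset.card_le_one.1 (not_lt.1 h) b (List.mem_toFinset.2 hb) a (List.mem_toFinset.2 ha)

theorem toFinset_map (l : List A) (f : A → B) : (l.map f).toFinset = l.toFinset.image f := by
  ext x
  simp

/-- The number of elements of `S` below `b`. -/
def rankIn (S : Finset A) (b : A) : ℕ := (S.filter (· < b)).card

theorem rankIn_lt_rankIn {S : Finset A} {a b : A} (ha : a ∈ S) (h : a < b) :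
    rankIn S a < rankIn S b := by
  refine Finset.card_lt_card ((Finset.ssubset_iff_of_subset fun x => ?_).2 ⟨a, ?_, ?_⟩)
  · simp only [Finset.mem_filter]
    exact fun hx => ⟨hx.1, hx.2.trans h⟩
  · simp [ha, h]
  · simp

theorem rankIn_injOn {S : Finset A} {a b : A} (ha : a ∈ S) (hb : b ∈ S)
    (h : rankIn S a = rankIn S b) : a = b := by
  rcases lt_trichotomy a b with hab | hab | hab
  · exact absurd h (rankIn_lt_rankIn ha hab).ne
  · exact hab
  · exact absurd h (rankIn_lt_rankIn hb hab).ne'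

theorem rankIn_image {S : Finset A} {g : A → B} (hg : ∀ x ∈ S, ∀ y ∈ S, x < y → g x < g y)
    {a : A} (ha : a ∈ S) : rankIn (S.image g) (g a) = rankIn S a := by
  have hg' : StrictMonoOn g S := fun x hx y hy h => hg x hx y hy h
  have : (S.image g).filter (· < g a) = (S.filter (· < a)).image g := by
    rw [Finset.filter_image]
    congr 1
    ext x
    simp only [Finset.mem_filter]
    exact and_congr_right fun hx => hg'.lt_iff_lt hx ha
  rw [rankIn, this, Finset.card_image_of_injOn]
  · rfl
  · exact hg'.injOn.mono fun x hx => (Finset.mem_filter.1 hx).1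

/-- The element of rank `j` of `S`; if there is none, the least element of `S`. -/
def nthElem [Nonempty A] (S : Finset A) (j : ℕ) : A :=
  if h : ∃ b ∈ S, rankIn S b = j then h.choose
  else if h : S.Nonempty then S.min' h else Classical.arbitrary A

theorem nthElem_rankIn [Nonempty A] {S : Finset A} {b : A} (hb : b ∈ S) :
    nthElem S (rankIn S b) = b := by
  have h : ∃ b' ∈ S, rankIn S b' = rankIn S b := ⟨b, hb, rfl⟩
  rw [nthElem, dif_pos h]
  exact rankIn_injOn h.choose_spec.1 hb h.choose_spec.2

theorem nthElem_eq_min' [Nonempty A] {S : Finset A} {j : ℕ} (hj : ¬ ∃ b ∈ S, rankIn S b = j)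
    (hS : S.Nonempty) : nthElem S j = S.min' hS := by
  rw [nthElem, dif_neg hj, dif_pos hS]

theorem nthElem_mem [Nonempty A] {S : Finset A} (hS : S.Nonempty) (j : ℕ) : nthElem S j ∈ S := by
  by_cases h : ∃ b ∈ S, rankIn S b = j
  · obtain ⟨b, hb, rfl⟩ := h
    rwa [nthElem_rankIn hb]
  · rw [nthElem_eq_min' h hS]
    exact S.min'_mem hS

theorem map_nthElem [Nonempty A] [Nonempty B] {S : Finset A} {g : A → B} (hS : S.Nonempty)
    (hg : ∀ x ∈ S, ∀ y ∈ S, x < y → g x < g y) (j : ℕ) :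
    g (nthElem S j) = nthElem (S.image g) j := by
  by_cases h : ∃ b ∈ S, rankIn S b = j
  · obtain ⟨b, hb, rfl⟩ := h
    rw [nthElem_rankIn hb, ← rankIn_image hg hb, nthElem_rankIn (Finset.mem_image_of_mem g hb)]
  · rw [nthElem_eq_min' h hS, nthElem_eq_min' _ (hS.image g)]
    · refine le_antisymm (Finset.le_min' _ _ _ fun y hy => ?_)
        (Finset.min'_le _ _ (Finset.mem_image_of_mem g (S.min'_mem hS)))
      obtain ⟨x, hx, rfl⟩ := Finset.mem_image.1 hy
      rcases (S.min'_le x hx).eq_or_lt with he | hlt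
      · rw [he]
      · exact (hg _ (S.min'_mem hS) _ hx hlt).le
    · rintro ⟨y, hy, hyj⟩
      obtain ⟨x, hx, rfl⟩ := Finset.mem_image.1 hy
      exact h ⟨x, hx, by rw [← hyj, rankIn_image hg hx]⟩

theorem rankIn_getElem_of_tpRel_eq {l : List A} {l' : List B} (h : tpRel l = tpRel l') {i : ℕ}
    (hi : i < l.length) (hi' : i < l'.length) :
    rankIn l.toFinset l[i] = rankIn l'.toFinset l'[i] := by
  have hlen := length_eq_of_tpRel_eq h
  have h1 : l.toFinset.filter (· < l[i]) =
      ((Finset.univ : Finset (Fin l.length)).filter fun q => l.get q < l[i]).image l.get := by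
    rw [toFinset_eq_image_get, Finset.filter_image]
  have h2 : l'.toFinset.filter (· < l'[i]) =
      ((Finset.univ : Finset (Fin l.length)).filter fun q => l.get q < l[i]).image
        fun q => l'.get (q.cast hlen) := by
    ext x
    simp only [Finset.mem_filter, Finset.mem_image, Finset.mem_univ, true_and, List.mem_toFinset,
      List.mem_iff_get]
    constructor
    · rintro ⟨⟨q, rfl⟩, hq⟩
      refine ⟨q.cast hlen.symm, ?_, rfl⟩
      rw [← not_le] at hq ⊢
      exact fun hle => hq ((getElem_le_iff_of_tpRel_eq h hi (q.cast hlen.symm).2 hi' q.2).1 hle)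
    · rintro ⟨q, hq, rfl⟩
      refine ⟨⟨_, rfl⟩, ?_⟩
      rw [← not_le] at hq ⊢
      exact fun hle => hq ((getElem_le_iff_of_tpRel_eq h hi q.2 hi' (q.cast hlen).2).2 hle)
  rw [rankIn, rankIn, h1, h2]
  refine card_image_eq_card_image fun q _ q' _ => ?_
  rw [le_antisymm_iff, le_antisymm_iff]
  exact and_congr (getElem_le_iff_of_tpRel_eq h q.2 q'.2 (q.cast hlen).2 (q'.cast hlen).2)
    (getElem_le_iff_of_tpRel_eq h q'.2 q.2 (q'.cast hlen).2 (q.cast hlen).2)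

/-- A tuple is determined by its set of entries and any tuple of the same type. -/
theorem map_nthElem_rankIn [Nonempty B] {l : List A} {l' : List B} (h : tpRel l = tpRel l') :
    l.map (fun b => nthElem l'.toFinset (rankIn l.toFinset b)) = l' := by
  refine List.ext_getElem (by rw [List.length_map, length_eq_of_tpRel_eq h]) fun i hi hi' => ?_
  rw [List.length_map] at hi
  rw [List.getElem_map, rankIn_getElem_of_tpRel_eq h hi hi', nthElem_rankIn]
  exact List.mem_toFinset.2 (List.getElem_mem _)

theorem eq_of_tpRel_eq_of_toFinset_eq {l l' : List A} (h : tpRel l = tpRel l')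
    (h' : l.toFinset = l'.toFinset) : l = l' := by
  rcases l.eq_nil_or_concat with rfl | ⟨_, a, -⟩
  · have := length_eq_of_tpRel_eq h
    exact (List.length_eq_zero_iff.1 this.symm).symm
  · have : Nonempty A := ⟨a⟩
    rw [← map_nthElem_rankIn h, ← h', map_nthElem_rankIn rfl]

end Tuples

section Quotients

variable {Θ : Type*} {ar : Θ → ℕ} {M N : ORelObj Θ ar} {f : M.carrier → N.carrier}

theorem ORelObj.ne_nil {θ : Θ} (hθ : ar θ ≠ 0) {l : List M.carrier} (hl : l ∈ M.rel θ) :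
    l ≠ [] := by
  rintro rfl
  exact hθ (M.len θ _ hl).symm

theorem ORelObj.exists_eq_replicate {θ : Θ} (hθ : ar θ ≠ 0) {l : List M.carrier}
    (hl : l ∈ M.rel θ) (h : ¬ 1 < l.toFinset.card) : ∃ a, l = List.replicate (ar θ) a := by
  obtain ⟨a, -, ha⟩ := _root_.exists_eq_replicate (M.ne_nil hθ hl) h
  rw [M.len θ l hl] at ha
  exact ⟨a, ha⟩

theorem one_lt_card_map_iff {A B : Type*} [LinearOrder B] {l : List A}
    {f : A → B} :
    1 < (l.map f).toFinset.card ↔ ¬ ∀ x ∈ l, ∀ y ∈ l, f x = f y := by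
  rw [← not_le, Finset.card_le_one]
  simp

theorem one_lt_card_of_map {A B : Type*} [LinearOrder A] [LinearOrder B] {l : List A}
    {f : A → B}
    (h : 1 < (l.map f).toFinset.card) : 1 < l.toFinset.card := by
  rw [toFinset_map] at h
  exact h.trans_le Finset.card_image_le

theorem replicate_injective {α : Type*} {r : ℕ} (hr : r ≠ 0) {a b : α}
    (h : List.replicate r a = List.replicate r b) : a = b := by
  have := List.replicate_inj.1 h
  tauto

/-- The least preimage of a constant tuple is constant. -/
theorem ORelObj.minWrt_replicate {θ : Θ} (hθ : ar θ ≠ 0) {p : N.carrier} {c : M.carrier}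
    (hc : f c = p) (hmin : ∀ d, f d = p → c ≤ d) :
    MinWrt salLT {u | u ∈ M.rel θ ∧ u.map f = List.replicate (ar θ) p}
      (List.replicate (ar θ) c) := by
  refine ⟨⟨M.refl θ c, by rw [List.map_replicate, hc]⟩, ?_⟩
  rintro l ⟨hl, hlp⟩
  by_cases h : 1 < l.toFinset.card
  · refine Or.inr (salLT_of_card_lt (by rw [M.len θ l hl, List.length_replicate]) ?_)
    rwa [List.toFinset_replicate_of_ne_zero hθ, Finset.card_singleton]
  · obtain ⟨a, rfl⟩ := M.exists_eq_replicate hθ hl h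
    rw [List.map_replicate] at hlp
    rcases (hmin a (replicate_injective hθ hlp)).eq_or_lt with h | h
    · exact Or.inl (by rw [h])
    · exact Or.inr ((salLT_replicate hθ).2 h)

namespace IsSRQstr

theorem isRigid (hf : IsSRQstr M N f) {θ : Θ} (hθ : ar θ ≠ 0) : IsRigid f := by
  obtain ⟨-, ⟨-, hsurj, hrig⟩, -⟩ := hf θ
  have hsurj' : Function.Surjective f := by
    intro p
    obtain ⟨l, hl, hlp⟩ := hsurj _ (N.refl θ p)
    obtain ⟨a, ha⟩ := List.exists_mem_of_ne_nil l (M.ne_nil hθ hl)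
    have : f a ∈ List.replicate (ar θ) p := hlp ▸ List.mem_map_of_mem ha
    exact ⟨a, List.eq_of_mem_replicate this⟩
  have hmin : ∀ p, ∃ c, f c = p ∧ ∀ d, f d = p → c ≤ d := by
    intro p
    have hne : (Finset.univ.filter fun c => f c = p).Nonempty := by
      obtain ⟨a, ha⟩ := hsurj' p
      exact ⟨a, by simpa using ha⟩
    refine ⟨Finset.min' _ hne, by simpa using Finset.min'_mem _ hne, fun d hd => ?_⟩
    exact Finset.min'_le _ _ (by simpa using hd)
  refine ⟨hsurj', fun i v hv => ?_⟩
  obtain ⟨c, hc, hcmin⟩ := hmin v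
  obtain ⟨d, hd, hdmin⟩ := hmin (f i)
  have := hrig _ (N.refl θ v) _ (N.refl θ (f i)) ((salLT_replicate hθ).2 hv) _ _
    (ORelObj.minWrt_replicate hθ hc hcmin) (ORelObj.minWrt_replicate hθ hd hdmin)
  exact ⟨c, ((salLT_replicate hθ).1 this).trans_le (hdmin i rfl), hc⟩

theorem map_lt (hf : IsSRQstr M N f) {θ : Θ} {l : List M.carrier} (hl : l ∈ M.rel θ)
    (h : 1 < (l.map f).toFinset.card) : ∀ x ∈ l, ∀ y ∈ l, x < y → f x < f y :=
  (hf θ).2.2 l hl (one_lt_card_map_iff.1 h)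

theorem tpRel_map (hf : IsSRQstr M N f) {θ : Θ} {l : List M.carrier} (hl : l ∈ M.rel θ)
    (h : 1 < (l.map f).toFinset.card) : tpRel (l.map f) = tpRel l :=
  _root_.tpRel_map (hf.map_lt hl h)

theorem exists_minWrt (hf : IsSRQstr M N f) {θ : Θ} {y : List N.carrier} (hy : y ∈ N.rel θ)
    (h : 1 < y.toFinset.card) : ∃ a, MinWrt salLT {u | u ∈ M.rel θ ∧ u.map f = y} a := by
  obtain ⟨l, hl, hly⟩ := (hf θ).2.1.2.1 y hy
  have htp : ∀ u ∈ {u | u ∈ M.rel θ ∧ u.map f = y}, tpRel u = tpRel y := by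
    rintro u ⟨hu, rfl⟩
    exact (hf.tpRel_map hu h).symm
  have : Finite (Colex (Finset M.carrier)) := Finite.of_equiv _ toColex
  have hwf : WellFounded (fun X Y : List M.carrier => toColex X.toFinset < toColex Y.toFinset) :=
    InvImage.wf (fun X : List M.carrier => toColex X.toFinset)
      (Finite.wellFounded_of_trans_of_irrefl _)
  obtain ⟨a, ha, hamin⟩ := hwf.has_min {u | u ∈ M.rel θ ∧ u.map f = y} ⟨l, hl, hly⟩
  refine ⟨a, ha, fun x hx => ?_⟩
  have htpx : tpRel a = tpRel x := (htp a ha).trans (htp x hx).symm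
  rcases lt_or_eq_of_le (not_lt.1 (hamin x hx)) with h | h
  · exact Or.inr ((salLT_iff_altLex htpx).2 (altLex_iff_toColex_lt.2 h))
  · exact Or.inl (eq_of_tpRel_eq_of_toFinset_eq htpx.symm (toColex.injective h).symm)

theorem exists_altLex (hf : IsSRQstr M N f) {θ : Θ} {l : List M.carrier} (hl : l ∈ M.rel θ)
    (h : 1 < (l.map f).toFinset.card) {y : List N.carrier} (hy : y ∈ N.rel θ)
    (htp : tpRel y = tpRel l) (hlt : altLex y.toFinset (l.map f).toFinset) :
    ∃ x ∈ M.rel θ, x.map f = y ∧ altLex x.toFinset l.toFinset := by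
  have htpl := hf.tpRel_map hl h
  have htp' : tpRel y = tpRel (l.map f) := htp.trans htpl.symm
  have hy1 : 1 < y.toFinset.card := by rwa [card_toFinset_eq_of_tpRel_eq htp']
  obtain ⟨a, ha⟩ := hf.exists_minWrt hy hy1
  obtain ⟨b, hb⟩ := hf.exists_minWrt ((hf θ).1 l hl) h
  have hab := (hf θ).2.1.2.2 _ hy _ ((hf θ).1 l hl) ((salLT_iff_altLex htp').2 hlt) a b ha hb
  have htpa : tpRel a = tpRel l := by
    rw [← htp, ← ha.1.2, hf.tpRel_map ha.1.1 (by rwa [ha.1.2])]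
  have htpb : tpRel b = tpRel l := by
    rw [← htpl, ← hb.1.2, hf.tpRel_map hb.1.1 (by rwa [hb.1.2])]
  refine ⟨a, ha.1.1, ha.1.2, ?_⟩
  rw [salLT_iff_altLex (htpa.trans htpb.symm)] at hab
  rcases hb.2 l ⟨hl, rfl⟩ with h | h
  · rwa [h]
  · exact hab.trans ((salLT_iff_altLex htpb).1 h)

/-- A criterion for strong rigid quotient maps. -/
theorem of_isRigid (hhom : ∀ θ, ∀ l ∈ M.rel θ, l.map f ∈ N.rel θ)
    (hsurj : ∀ θ, ∀ y ∈ N.rel θ, ∃ l ∈ M.rel θ, l.map f = y)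
    (hrig : ∀ θ, ar θ ≠ 0 → IsRigid f)
    (hmono : ∀ θ, ∀ l ∈ M.rel θ, 1 < (l.map f).toFinset.card →
      ∀ x ∈ l, ∀ y ∈ l, x < y → f x < f y)
    (hlex : ∀ θ, ∀ l ∈ M.rel θ, 1 < (l.map f).toFinset.card → ∀ y ∈ N.rel θ, tpRel y = tpRel l →
      altLex y.toFinset (l.map f).toFinset →
        ∃ x ∈ M.rel θ, x.map f = y ∧ altLex x.toFinset l.toFinset) :
    IsSRQstr M N f := by
  intro θ
  refine ⟨hhom θ, ⟨hhom θ, hsurj θ, ?_⟩, fun l hl h => hmono θ l hl (one_lt_card_map_iff.2 h)⟩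
  intro x hx y hy hxy a b ha hb
  by_cases hθ : ar θ = 0
  · have h0 : ∀ z ∈ N.rel θ, z = [] := fun z hz =>
      List.length_eq_zero_iff.1 ((N.len θ z hz).trans hθ)
    rw [h0 x hx, h0 y hy, salLT_iff_altLex rfl] at hxy
    exact absurd hxy (altLex_irrefl _)
  have hlen : a.length = b.length := (M.len θ a ha.1.1).trans (M.len θ b hb.1.1).symm
  have hconst : ∀ p a, MinWrt salLT {u | u ∈ M.rel θ ∧ u.map f = List.replicate (ar θ) p} a →
      ∃ c, a = List.replicate (ar θ) c ∧ f c = p ∧ ∀ d, f d = p → c ≤ d := by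
    intro p a ha
    have key : ∀ d, f d = p → a = List.replicate (ar θ) d ∨ salLT a (List.replicate (ar θ) d) :=
      fun d hd => (ha.2 _ ⟨M.refl θ d, by rw [List.map_replicate, hd]⟩).imp_left Eq.symm
    obtain ⟨d, hd⟩ := (hrig θ hθ).1 p
    have hcard : ¬ 1 < a.toFinset.card := by
      rw [not_lt]
      have : (List.replicate (ar θ) d).toFinset.card = 1 := by
        rw [List.toFinset_replicate_of_ne_zero hθ, Finset.card_singleton]
      rcases key d hd with h | h
      · rw [h, this]
      · exact this ▸ h.card_le
    obtain ⟨c, rfl⟩ := M.exists_eq_replicate hθ ha.1.1 hcard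
    have hcp := ha.1.2
    rw [List.map_replicate] at hcp
    refine ⟨c, rfl, replicate_injective hθ hcp, fun d hd => ?_⟩
    rcases key d hd with h | h
    · exact (replicate_injective hθ h).le
    · exact ((salLT_replicate hθ).1 h).le
  by_cases hx1 : 1 < x.toFinset.card
  · have hy1 : 1 < y.toFinset.card := hx1.trans_le hxy.card_le
    have htpa : tpRel a = tpRel x := by
      rw [← ha.1.2]
      exact (_root_.tpRel_map (hmono θ a ha.1.1 (by rwa [ha.1.2]))).symm
    have htpb : tpRel b = tpRel y := by
      rw [← hb.1.2]
      exact (_root_.tpRel_map (hmono θ b hb.1.1 (by rwa [hb.1.2]))).symm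
    rcases hxy.2 with h | ⟨h, -, h'⟩
    · rw [← htpa, ← htpb, N.len θ x hx, ← M.len θ a ha.1.1] at h
      exact ⟨hlen, Or.inl h⟩
    · obtain ⟨l, hl, hlx, hlb⟩ := hlex θ b hb.1.1 (by rwa [hb.1.2]) x hx (h.trans htpb.symm)
        (by rwa [hb.1.2])
      have htpl : tpRel l = tpRel x := by
        rw [← hlx]
        exact (_root_.tpRel_map (hmono θ l hl (by rwa [hlx]))).symm
      rw [salLT_iff_altLex (by rw [htpa, htpb, h])]
      rcases ha.2 l ⟨hl, hlx⟩ with h1 | h1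
      · rwa [← h1]
      · exact ((salLT_iff_altLex (htpa.trans htpl.symm)).1 h1).trans hlb
  obtain ⟨p, rfl⟩ := N.exists_eq_replicate hθ hx hx1
  obtain ⟨c, rfl, hc, hcmin⟩ := hconst p a ha
  by_cases hy1 : 1 < y.toFinset.card
  · refine salLT_of_card_lt hlen ?_
    rw [List.toFinset_replicate_of_ne_zero hθ, Finset.card_singleton]
    exact one_lt_card_of_map (f := f) (by rwa [hb.1.2])
  · obtain ⟨q, rfl⟩ := N.exists_eq_replicate hθ hy hy1
    obtain ⟨d, rfl, hd, -⟩ := hconst q b hb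
    rw [salLT_replicate hθ] at hxy ⊢
    obtain ⟨j, hj, hjp⟩ := (hrig θ hθ).2 d p (by rwa [hd])
    exact (hcmin j hjp).trans_lt hj

end IsSRQstr

end Quotients

section EdgeChains

variable {A B : Type} {N : ℕ}

/-- The chain of the points of `A`, followed by the edges: pairs of an index `t` and a set in
`P t`, ordered by index and then anti-lexicographically. -/
def EdgeChain (P : Fin N → Finset (Finset A)) : Type :=
  A ⊕ {x : Fin N × Finset A // x.2 ∈ P x.1}

namespace EdgeChain

variable {P : Fin N → Finset (Finset A)} {Q : Fin N → Finset (Finset B)}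

/-- A point, as a member of the edge chain. -/
def point (a : A) : EdgeChain P := Sum.inl a

/-- An edge, as a member of the edge chain. -/
def edge (t : Fin N) (S : Finset A) (h : S ∈ P t) : EdgeChain P := Sum.inr ⟨(t, S), h⟩

theorem point_or_edge (x : EdgeChain P) : (∃ a, x = point a) ∨ ∃ t S h, x = edge t S h := by
  rcases x with a | ⟨⟨t, S⟩, h⟩
  · exact Or.inl ⟨a, rfl⟩
  · exact Or.inr ⟨t, S, h, rfl⟩

/-- The embedding into a lexicographic sum of lexicographic products. -/
def toLexSum : EdgeChain P → A ⊕ₗ (Fin N ×ₗ Colex (Finset A)) :=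
  fun x => toLex (Sum.map id (fun y => toLex (y.1.1, toColex y.1.2)) x)

theorem toLexSum_injective : Function.Injective (toLexSum (P := P)) := by
  refine toLex.injective.comp (Sum.map_injective.2 ⟨Function.injective_id, ?_⟩)
  rintro ⟨⟨t, S⟩, h⟩ ⟨⟨t', S'⟩, h'⟩ he
  have he' := toLex.injective he
  simp only [Prod.mk.injEq, EmbeddingLike.apply_eq_iff_eq] at he'
  obtain ⟨rfl, rfl⟩ := he'
  rfl

variable [LinearOrder A] [LinearOrder B]

instance : LinearOrder (EdgeChain P) := LinearOrder.lift' toLexSum toLexSum_injective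

instance [Fintype A] : Fintype (EdgeChain P) :=
  inferInstanceAs (Fintype (A ⊕ {x : Fin N × Finset A // x.2 ∈ P x.1}))

instance [Nonempty A] : Nonempty (EdgeChain P) := ⟨point (Classical.arbitrary A)⟩

theorem point_lt_point {a b : A} : (point a : EdgeChain P) < point b ↔ a < b :=
  Sum.Lex.inl_lt_inl_iff

theorem point_lt_edge {a : A} {t : Fin N} {S : Finset A} (h : S ∈ P t) : point a < edge t S h :=
  Sum.Lex.inl_lt_inr _ _

theorem not_edge_lt_point {a : A} {t : Fin N} {S : Finset A} (h : S ∈ P t) :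
    ¬ edge t S h < point a :=
  (point_lt_edge h).not_gt

theorem edge_lt_edge {t t' : Fin N} {S S' : Finset A} {h : S ∈ P t} {h' : S' ∈ P t'} :
    edge t S h < edge t' S' h' ↔ t < t' ∨ t = t' ∧ altLex S S' := by
  rw [altLex_iff_toColex_lt]
  exact Sum.Lex.inr_lt_inr_iff.trans Prod.Lex.toLex_lt_toLex

/-- The map between edge chains induced by a map of the points; edges whose image is not an edge
are collapsed to points. -/
def map [Nonempty A] (P : Fin N → Finset (Finset A)) (Q : Fin N → Finset (Finset B)) (g : A → B) :
    EdgeChain P → EdgeChain Q :=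
  Sum.elim (fun a => point (g a)) fun x =>
    if h : x.1.2.image g ∈ Q x.1.1 then edge x.1.1 (x.1.2.image g) h
    else point (g (nthElem x.1.2 0))

theorem map_point [Nonempty A] (g : A → B) (a : A) : map P Q g (point a) = point (g a) := rfl

theorem map_edge [Nonempty A] {g : A → B} {t : Fin N} {S : Finset A} (h : S ∈ P t)
    (h' : S.image g ∈ Q t) : map P Q g (edge t S h) = edge t (S.image g) h' :=
  dif_pos h'

theorem map_edge_of_notMem [Nonempty A] {g : A → B} {t : Fin N} {S : Finset A} (h : S ∈ P t)
    (h' : S.image g ∉ Q t) : map P Q g (edge t S h) = point (g (nthElem S 0)) :=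
  dif_neg h'

/-- Reading off a member of an edge chain: a point reads as itself, an edge of index `t` as its
element of rank `j`, and any other edge as its least element. -/
def read [Nonempty A] (t : Fin N) (j : ℕ) : EdgeChain P → A :=
  Sum.elim id fun x => nthElem x.1.2 (if x.1.1 = t then j else 0)

theorem read_point [Nonempty A] (t : Fin N) (j : ℕ) (a : A) :
    read t j (point a : EdgeChain P) = a := rfl

theorem read_edge [Nonempty A] (t t' : Fin N) (j : ℕ) {S : Finset A} (h : S ∈ P t') :
    read t j (edge t' S h) = nthElem S (if t' = t then j else 0) := rfl

theorem map_read [Nonempty A] [Nonempty B] {g : A → B} (hP : ∀ t, ∀ S ∈ P t, S.Nonempty)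
    (hmono : ∀ t, ∀ S ∈ P t, S.image g ∈ Q t → ∀ x ∈ S, ∀ y ∈ S, x < y → g x < g y)
    (hconst : ∀ t, ∀ S ∈ P t, S.image g ∉ Q t → ∀ x ∈ S, ∀ y ∈ S, g x = g y)
    (t : Fin N) (j : ℕ) (x : EdgeChain P) : g (read t j x) = read t j (map P Q g x) := by
  rcases point_or_edge x with ⟨a, rfl⟩ | ⟨t', S, h, rfl⟩
  · rfl
  by_cases h' : S.image g ∈ Q t'
  · rw [map_edge h h', read_edge, read_edge, map_nthElem (hP _ _ h) (hmono _ _ h h')]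
  · rw [map_edge_of_notMem h h', read_edge, read_point]
    exact hconst _ _ h h' _ (nthElem_mem (hP _ _ h) _) _ (nthElem_mem (hP _ _ h) _)

theorem isRigid_map [Nonempty A] {g : A → B} (hg : IsRigid g)
    (hsurj : ∀ t, ∀ S ∈ Q t, ∃ S' ∈ P t, S'.image g = S)
    (hlex : ∀ t, ∀ S ∈ P t, S.image g ∈ Q t → ∀ S₀ ∈ Q t, altLex S₀ (S.image g) →
      ∃ S' ∈ P t, S'.image g = S₀ ∧ altLex S' S) :
    IsRigid (map P Q g) := by
  have hedge : ∀ t S (h : S ∈ Q t),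
      ∃ S', ∃ h' : S' ∈ P t, map P Q g (edge t S' h') = edge t S h := by
    intro t S h
    obtain ⟨S', h', rfl⟩ := hsurj t S h
    exact ⟨S', h', map_edge h' h⟩
  refine ⟨fun y => ?_, fun x y hyx => ?_⟩
  · rcases point_or_edge y with ⟨a, rfl⟩ | ⟨t, S, h, rfl⟩
    · obtain ⟨b, rfl⟩ := hg.1 a
      exact ⟨point b, rfl⟩
    · obtain ⟨S', h', hS'⟩ := hedge t S h
      exact ⟨_, hS'⟩
  · rcases point_or_edge x with ⟨a, rfl⟩ | ⟨t, S, h, rfl⟩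
    · rw [map_point] at hyx
      rcases point_or_edge y with ⟨b, rfl⟩ | ⟨t, S, h, rfl⟩
      · obtain ⟨j, hj, rfl⟩ := hg.2 a b (point_lt_point.1 hyx)
        exact ⟨point j, point_lt_point.2 hj, rfl⟩
      · exact absurd hyx (not_edge_lt_point h)
    · rcases point_or_edge y with ⟨b, rfl⟩ | ⟨t', S₀, h₀, rfl⟩
      · obtain ⟨j, rfl⟩ := hg.1 b
        exact ⟨point j, point_lt_edge h, rfl⟩
      by_cases h' : S.image g ∈ Q t
      · rw [map_edge h h', edge_lt_edge] at hyx
        rcases hyx with hlt | ⟨rfl, hlt⟩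
        · obtain ⟨S', hS', he⟩ := hedge t' S₀ h₀
          exact ⟨_, edge_lt_edge.2 (Or.inl hlt), he⟩
        · obtain ⟨S', hS', rfl, hlt'⟩ := hlex _ S h h' S₀ h₀ hlt
          exact ⟨_, edge_lt_edge.2 (Or.inr ⟨rfl, hlt'⟩), map_edge hS' h₀⟩
      · rw [map_edge_of_notMem h h'] at hyx
        exact absurd hyx (not_edge_lt_point h₀)

end EdgeChain

end EdgeChains

section Construction

/-- The sets of entries of the nonconstant `θ`-tuples of type `σ`. -/
def ORelObj.edges {Θ : Type*} {ar : Θ → ℕ} (M : ORelObj Θ ar) (θ : Θ) (σ : ℕ → ℕ → Prop) :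
    Finset (Finset M.carrier) :=
  Finset.univ.filter fun S => 1 < S.card ∧ ∃ l ∈ M.rel θ, tpRel l = σ ∧ l.toFinset = S

theorem ORelObj.mem_edges {Θ : Type*} {ar : Θ → ℕ} {M : ORelObj Θ ar} {θ : Θ}
    {σ : ℕ → ℕ → Prop} {S : Finset M.carrier} :
    S ∈ M.edges θ σ ↔ 1 < S.card ∧ ∃ l ∈ M.rel θ, tpRel l = σ ∧ l.toFinset = S := by
  simp [ORelObj.edges]

/-- A family over an arbitrary index type with values in a finite type factors through a finite
set of indices. -/
theorem exists_index (ι : Type*) (X : Type*) [Finite X] (F : ι → X) :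
    ∃ (N : ℕ) (t : ι → Fin N) (G : Fin N → X), Function.Surjective t ∧ ∀ i, G (t i) = F i := by
  obtain ⟨N, ⟨e⟩⟩ := Finite.exists_equiv_fin (Set.range F)
  refine ⟨N, fun i => e ⟨F i, i, rfl⟩, fun s => (e.symm s : X), fun s => ?_, fun i => by simp⟩
  obtain ⟨i, hi⟩ := (e.symm s).2
  exact ⟨i, (e.symm_apply_eq.1 (Subtype.ext hi.symm)).symm⟩

variable {Θ : Type} {ar : Θ → ℕ}

theorem map_lt_of_tpRel_map_eq {A B : Type*} [LinearOrder A] [LinearOrder B] {l : List A} {f : A → B}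
    (h : tpRel (l.map f) = tpRel l) : ∀ x ∈ l, ∀ y ∈ l, x < y → f x < f y := by
  intro x hx y hy hxy
  obtain ⟨p, hp, rfl⟩ := List.mem_iff_getElem.1 hx
  obtain ⟨q, hq, rfl⟩ := List.mem_iff_getElem.1 hy
  rw [← not_le] at hxy ⊢
  rw [← getElem_le_iff_of_tpRel_eq h (by simpa using hq) (by simpa using hp) hq hp] at hxy
  simpa using hxy

theorem map_read_of_isSRQstr {M N : ORelObj Θ ar} [Nonempty M.carrier] [Nonempty N.carrier]
    {g : M.carrier → N.carrier} (hg : IsSRQstr M N g) {r : ℕ} {t : Θ × (ℕ → ℕ → Prop) → Fin r}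
    (ht : Function.Surjective t) {P : Fin r → Finset (Finset M.carrier)}
    {Q : Fin r → Finset (Finset N.carrier)} (hP : ∀ i, P (t i) = M.edges i.1 i.2)
    (hQ : ∀ i, Q (t i) = N.edges i.1 i.2) (s : Fin r) (j : ℕ) (x : EdgeChain P) :
    g (x.read s j) = (EdgeChain.map P Q g x).read s j := by
  refine EdgeChain.map_read (fun s S hS => ?_) (fun s S hS hS' => ?_) (fun s S hS hS' => ?_) s j x
  all_goals
    obtain ⟨⟨θ, σ⟩, rfl⟩ := ht s
    rw [hP, ORelObj.mem_edges] at hS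
    obtain ⟨hS1, l, hl, rfl, rfl⟩ := hS
  · exact Finset.card_pos.1 (by omega)
  · rw [hQ, ORelObj.mem_edges, ← toFinset_map] at hS'
    simpa using hg.map_lt hl hS'.1
  · by_contra hne
    have h1 : 1 < (l.map g).toFinset.card := one_lt_card_map_iff.2 (by simpa using hne)
    rw [hQ, ORelObj.mem_edges, ← toFinset_map] at hS'
    exact hS' ⟨h1, l.map g, (hg θ).1 l hl, hg.tpRel_map hl h1, rfl⟩

theorem isRigid_map_of_isSRQstr {M N : ORelObj Θ ar} [Nonempty M.carrier]
    {g : M.carrier → N.carrier} (hg : IsSRQstr M N g) {θ₀ : Θ} (hθ₀ : ar θ₀ ≠ 0) {r : ℕ}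
    {t : Θ × (ℕ → ℕ → Prop) → Fin r} (ht : Function.Surjective t)
    {P : Fin r → Finset (Finset M.carrier)} {Q : Fin r → Finset (Finset N.carrier)}
    (hP : ∀ i, P (t i) = M.edges i.1 i.2) (hQ : ∀ i, Q (t i) = N.edges i.1 i.2) :
    IsRigid (EdgeChain.map P Q g) := by
  refine EdgeChain.isRigid_map (hg.isRigid hθ₀) (fun s S hS => ?_) fun s S hS hS' S₀ hS₀ hlt => ?_
  · obtain ⟨⟨θ, σ⟩, rfl⟩ := ht s
    rw [hQ, ORelObj.mem_edges] at hS
    obtain ⟨hS1, y, hy, rfl, rfl⟩ := hS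
    obtain ⟨l, hl, rfl⟩ := (hg θ).2.1.2.1 y hy
    refine ⟨l.toFinset, ?_, (toFinset_map l g).symm⟩
    rw [hP, ORelObj.mem_edges]
    exact ⟨one_lt_card_of_map hS1, l, hl, (hg.tpRel_map hl hS1).symm, rfl⟩
  · obtain ⟨⟨θ, σ⟩, rfl⟩ := ht s
    rw [hP, ORelObj.mem_edges] at hS
    obtain ⟨hS1, l, hl, rfl, rfl⟩ := hS
    rw [hQ, ORelObj.mem_edges] at hS' hS₀
    obtain ⟨hS₀1, y, hy, htp, rfl⟩ := hS₀
    rw [← toFinset_map] at hS' hlt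
    obtain ⟨x, hx, rfl, hxl⟩ := hg.exists_altLex hl hS'.1 hy htp hlt
    refine ⟨x.toFinset, ?_, (toFinset_map x g).symm, hxl⟩
    rw [hP, ORelObj.mem_edges]
    exact ⟨one_lt_card_of_map hS₀1, x, hx, (hg.tpRel_map hx hS₀1).symm.trans htp, rfl⟩

/-- The rank of an element in a finite set, as an element of a fixed finite chain. -/
def finRank {A : Type*} [LinearOrder A] [Fintype A] (S : Finset A) (b : A) :
    Fin (Fintype.card A + 1) :=
  ⟨rankIn S b, Nat.lt_succ_of_le (Finset.card_le_univ _)⟩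

variable (B : ORelObj Θ ar) (n : ℕ) {r : ℕ} (t : Θ × (ℕ → ℕ → Prop) → Fin r)

/-- The copy at place `i` of a tuple of `B`. -/
def copyTuple (i : Fin n) (θ : Θ) (l : List B.carrier) :
    List (Fin n ×ₗ (Fin r ×ₗ Fin (Fintype.card B.carrier + 1))) :=
  l.map fun b => toLex (i, toLex (t (θ, tpRel l), finRank l.toFinset b))

theorem tpRel_copyTuple (i : Fin n) (θ : Θ) (l : List B.carrier) :
    tpRel (copyTuple B n t i θ l) = tpRel l := by
  refine tpRel_map fun x hx y _ hxy => ?_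
  exact Prod.Lex.toLex_lt_toLex.2 (Or.inr ⟨rfl, Prod.Lex.toLex_lt_toLex.2
    (Or.inr ⟨rfl, rankIn_lt_rankIn (List.mem_toFinset.2 hx) hxy⟩)⟩)

/-- The structure consisting of one copy of every nonconstant tuple of `B` at each of `n`
places. -/
abbrev copies : ORelObj Θ ar where
  carrier := Fin n ×ₗ (Fin r ×ₗ Fin (Fintype.card B.carrier + 1))
  fintypeI := inferInstanceAs (Fintype (Fin n × (Fin r × Fin (Fintype.card B.carrier + 1))))
  rel θ := {l | (∃ c, l = List.replicate (ar θ) c) ∨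
    ∃ i, ∃ l' ∈ B.rel θ, 1 < l'.toFinset.card ∧ l = copyTuple B n t i θ l'}
  len := by
    rintro θ l (⟨c, rfl⟩ | ⟨i, l', hl', -, rfl⟩)
    · exact List.length_replicate
    · rw [copyTuple, List.length_map, B.len θ l' hl']
  refl θ c := Or.inl ⟨c, rfl⟩

variable {B n t} [Nonempty B.carrier]

/-- The map on the copies determined by a word over an edge chain. -/
def wordMap {A : Type} [LinearOrder A] [Nonempty A] {m : ℕ} {P : Fin r → Finset (Finset A)}
    (u : Fin n → EdgeChain P) (c : Fin n ×ₗ (Fin r ×ₗ Fin m)) : A :=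
  (u (ofLex c).1).read (ofLex (ofLex c).2).1 (ofLex (ofLex c).2).2

variable {P : Fin r → Finset (Finset B.carrier)} {u : Fin n → EdgeChain P}

theorem map_wordMap_copyTuple {θ : Θ} {l l' : List B.carrier} (h : tpRel l = tpRel l')
    {i : Fin n} {hl' : l'.toFinset ∈ P (t (θ, tpRel l))}
    (hu : u i = EdgeChain.edge (t (θ, tpRel l)) l'.toFinset hl') :
    (copyTuple B n t i θ l).map (wordMap u) = l' := by
  rw [copyTuple, List.map_map]
  refine Eq.trans (List.map_congr_left fun b _ => ?_) (map_nthElem_rankIn h)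
  simp [wordMap, hu, EdgeChain.read_edge, finRank]

theorem map_wordMap_copyTuple_cases (hP : ∀ i, P (t i) = B.edges i.1 i.2) {θ : Θ}
    {l : List B.carrier} (hl : l ∈ B.rel θ) (i : Fin n) :
    (∃ p, (copyTuple B n t i θ l).map (wordMap u) = List.replicate (ar θ) p) ∨
      ∃ l' ∈ B.rel θ, ∃ hl', tpRel l = tpRel l' ∧
        u i = EdgeChain.edge (t (θ, tpRel l)) l'.toFinset hl' := by
  have hconst : ∀ p, (∀ j, (u i).read (t (θ, tpRel l)) j = p) →
      (copyTuple B n t i θ l).map (wordMap u) = List.replicate (ar θ) p := by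
    intro p hp
    rw [copyTuple, List.map_map, ← B.len θ l hl, ← List.map_const']
    exact List.map_congr_left fun b _ => hp _
  rcases EdgeChain.point_or_edge (u i) with ⟨p, hu⟩ | ⟨s, S, hS, hu⟩
  · exact Or.inl ⟨p, hconst p fun j => by rw [hu, EdgeChain.read_point]⟩
  by_cases hs : s = t (θ, tpRel l)
  · subst hs
    have hS' := hS
    rw [hP, ORelObj.mem_edges] at hS'
    obtain ⟨-, l', hl', htp, rfl⟩ := hS'
    exact Or.inr ⟨l', hl', hS, htp.symm, hu⟩
  · exact Or.inl ⟨nthElem S 0, hconst _ fun j => by rw [hu, EdgeChain.read_edge, if_neg hs]⟩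

theorem isSRQstr_wordMap (hP : ∀ i, P (t i) = B.edges i.1 i.2) (hu : IsRigid u) (s₀ : Fin r) :
    IsSRQstr (copies B n t) B (wordMap u) := by
  have hrig : ∀ c b, b < wordMap u c →
      ∃ d : Fin n ×ₗ (Fin r ×ₗ Fin (Fintype.card B.carrier + 1)), d < c ∧ wordMap u d = b := by
    intro c b hb
    have hlt : EdgeChain.point b < u (ofLex c).1 := by
      rcases EdgeChain.point_or_edge (u (ofLex c).1) with ⟨p, hp⟩ | ⟨s, S, hS, hp⟩
      · rw [wordMap, hp, EdgeChain.read_point] at hb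
        rwa [hp, EdgeChain.point_lt_point]
      · rw [hp]
        exact EdgeChain.point_lt_edge hS
    obtain ⟨j, hj, hjb⟩ := hu.2 _ _ hlt
    exact ⟨toLex (j, (ofLex c).2), Prod.Lex.lt_iff.2 (Or.inl hj), by simp [wordMap, hjb,
      EdgeChain.read_point]⟩
  have hsurj : Function.Surjective
      (wordMap u : Fin n ×ₗ (Fin r ×ₗ Fin (Fintype.card B.carrier + 1)) → B.carrier) := by
    intro b
    obtain ⟨j, hj⟩ := hu.1 (EdgeChain.point b)
    exact ⟨toLex (j, toLex (s₀, 0)), by simp [wordMap, hj, EdgeChain.read_point]⟩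
  have hedge : ∀ θ, ∀ l ∈ B.rel θ, 1 < l.toFinset.card → l.toFinset ∈ P (t (θ, tpRel l)) := by
    intro θ l hl h1
    rw [hP, ORelObj.mem_edges]
    exact ⟨h1, l, hl, rfl, rfl⟩
  have hconst : ∀ (θ : Θ) (p : B.carrier), ¬ 1 < (List.replicate (ar θ) p).toFinset.card := by
    intro θ p
    rw [not_lt, Finset.card_le_one]
    simp only [List.mem_toFinset, List.mem_replicate]
    rintro a ⟨-, rfl⟩ b ⟨-, rfl⟩
    rfl
  refine IsSRQstr.of_isRigid ?_ ?_ (fun θ _ => ⟨hsurj, hrig⟩) ?_ ?_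
  · rintro θ l (⟨c, rfl⟩ | ⟨i, l, hl, -, rfl⟩)
    · rw [List.map_replicate]
      exact B.refl θ _
    · rcases map_wordMap_copyTuple_cases (u := u) hP hl i with ⟨p, hp⟩ | ⟨l', hl', _, htp, hui⟩
      · rw [hp]
        exact B.refl θ p
      · rwa [map_wordMap_copyTuple htp hui]
  · intro θ y hy
    by_cases h1 : 1 < y.toFinset.card
    · obtain ⟨i, hi⟩ := hu.1 (EdgeChain.edge _ _ (hedge θ y hy h1))
      exact ⟨_, Or.inr ⟨i, y, hy, h1, rfl⟩, map_wordMap_copyTuple rfl hi⟩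
    · obtain ⟨p, rfl⟩ : ∃ p, y = List.replicate (ar θ) p := by
        by_cases hθ : ar θ = 0
        · refine ⟨Classical.arbitrary _, ?_⟩
          rw [hθ, List.replicate_zero, ← List.length_eq_zero_iff, B.len θ y hy, hθ]
        · exact B.exists_eq_replicate hθ hy h1
      obtain ⟨c, rfl⟩ := hsurj p
      exact ⟨_, Or.inl ⟨c, rfl⟩, List.map_replicate⟩
  · rintro θ l (⟨c, rfl⟩ | ⟨i, l, hl, -, rfl⟩) h1
    · rw [List.map_replicate] at h1
      exact absurd h1 (hconst _ _)
    · rcases map_wordMap_copyTuple_cases (u := u) hP hl i with ⟨p, hp⟩ | ⟨l', hl', _, htp, hui⟩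
      · rw [hp] at h1
        exact absurd h1 (hconst _ _)
      · refine map_lt_of_tpRel_map_eq ?_
        rw [map_wordMap_copyTuple htp hui, ← htp]
        exact (tpRel_copyTuple B n t i θ l).symm
  · rintro θ l (⟨c, rfl⟩ | ⟨i, l, hl, -, rfl⟩) h1 y hy htpy hlt
    · rw [List.map_replicate] at h1
      exact absurd h1 (hconst _ _)
    · rcases map_wordMap_copyTuple_cases (u := u) hP hl i with ⟨p, hp⟩ | ⟨l', hl', hS, htp, hui⟩
      · rw [hp] at h1
        exact absurd h1 (hconst _ _)
      · have htpy' : tpRel y = tpRel l := htpy.trans (tpRel_copyTuple B n t i θ l)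
        have h1' := h1
        rw [map_wordMap_copyTuple htp hui] at hlt h1'
        have hy1 : 1 < y.toFinset.card := by
          rwa [card_toFinset_eq_of_tpRel_eq (htpy'.trans htp)]
        obtain ⟨j, hj, hju⟩ := hu.2 i (EdgeChain.edge _ _ (hedge θ y hy hy1)) (by
          rw [hui, EdgeChain.edge_lt_edge]
          exact Or.inr ⟨by rw [htpy'], hlt⟩)
        refine ⟨_, Or.inr ⟨j, y, hy, hy1, rfl⟩, map_wordMap_copyTuple rfl hju, ?_⟩
        refine altLex_of_forall_lt ?_ fun x hx z hz => ?_
        · exact Finset.card_pos.1 (Nat.zero_lt_one.trans (one_lt_card_of_map h1))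
        · rw [List.mem_toFinset] at hx hz
          obtain ⟨x, -, rfl⟩ := List.mem_map.1 hx
          obtain ⟨z, -, rfl⟩ := List.mem_map.1 hz
          exact Prod.Lex.toLex_lt_toLex.2 (Or.inl hj)

end Construction

theorem exists_monochromatic {Θ : Type} {ar : Θ → ℕ} (κ : Type) [Finite κ] (A B : ORelObj Θ ar)
    [Nonempty A.carrier] [Nonempty B.carrier] {θ₀ : Θ} (hθ₀ : ar θ₀ ≠ 0) :
    ∃ C : ORelObj Θ ar, ∀ χ : (C.carrier → A.carrier) → κ,
      ∃ w : C.carrier → B.carrier, IsSRQstr C B w ∧ ∃ c, ∀ g : B.carrier → A.carrier,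
        IsSRQstr B A g → χ (g ∘ w) = c := by
  obtain ⟨r, t, G, ht, hG⟩ := exists_index (Θ × (ℕ → ℕ → Prop))
    (Finset (Finset B.carrier) × Finset (Finset A.carrier))
    fun i => (B.edges i.1 i.2, A.edges i.1 i.2)
  have hP : ∀ i, (G (t i)).1 = B.edges i.1 i.2 := fun i => by rw [hG]
  have hQ : ∀ i, (G (t i)).2 = A.edges i.1 i.2 := fun i => by rw [hG]
  obtain ⟨n, hn⟩ := exists_isRigid_monochromatic (EdgeChain fun s => (G s).2)
    (EdgeChain fun s => (G s).1) κ
  refine ⟨copies B n t, fun χ => ?_⟩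
  obtain ⟨u, hu, c, hc⟩ := hn fun v => χ (wordMap v)
  refine ⟨wordMap u, isSRQstr_wordMap hP hu (t (θ₀, fun _ _ => True)), c, fun g hg => ?_⟩
  rw [← hc _ (isRigid_map_of_isSRQstr hg hθ₀ ht hP hQ)]
  exact congrArg χ (funext fun d => map_read_of_isSRQstr hg ht hP hQ _ _ _)

/-- The structure without points in which the empty tuple satisfies the same relations as in
`B`. -/
abbrev emptyPart {Θ : Type} {ar : Θ → ℕ} (B : ORelObj Θ ar) : ORelObj Θ ar where
  carrier := Fin 0
  rel θ := {l | l = [] ∧ [] ∈ B.rel θ}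
  len := by
    rintro θ l ⟨rfl, h⟩
    exact B.len θ _ h
  refl _ a := a.elim0

theorem isSRQstr_emptyPart {Θ : Type} {ar : Θ → ℕ} (B : ORelObj Θ ar)
    (h : ∀ θ, ar θ ≠ 0 → IsEmpty B.carrier) (w : (emptyPart B).carrier → B.carrier) :
    IsSRQstr (emptyPart B) B w := by
  refine IsSRQstr.of_isRigid ?_ ?_ ?_ ?_ ?_
  · rintro θ l ⟨rfl, hl⟩
    exact hl
  · intro θ y hy
    obtain rfl : y = [] := by
      by_cases hθ : ar θ = 0
      · rw [← List.length_eq_zero_iff, B.len θ y hy, hθ]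
      · have := h θ hθ
        exact List.eq_nil_iff_forall_not_mem.2 fun a => isEmptyElim a
    exact ⟨[], ⟨rfl, hy⟩, rfl⟩
  · intro θ hθ
    have := h θ hθ
    exact ⟨fun b => isEmptyElim b, fun i => i.elim0⟩
  · rintro θ l - - x
    exact x.elim0
  · rintro θ l ⟨rfl, -⟩ h1
    simp at h1

/-- The Dual Nešetřil–Rödl Theorem, restricted form. For every
relational language `Θ` (with `⊏ ∉ Θ`), the category `Rel_srq(Θ,⊏)` of all finite
linearly ordered reflexive `Θ`-structures and strong rigid quotient maps of
structures has the dual Ramsey property. -/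
theorem stmt17 (Θ : Type) (ar : Θ → ℕ) :
    HasDualRamseyClass (fun M : ORelObj Θ ar => M.carrier) IsSRQstr := by
  intro k _ A _ B _ ⟨f, hf⟩
  by_cases h : Nonempty B.carrier ∧ ∃ θ, ar θ ≠ 0
  · obtain ⟨hB, θ₀, hθ₀⟩ := h
    have hA : Nonempty A.carrier := hB.map f
    obtain ⟨C, hC⟩ := exists_monochromatic (Fin k) A B hθ₀
    exact ⟨C, Set.mem_univ _, hC⟩
  · refine ⟨emptyPart B, Set.mem_univ _, fun χ => ?_⟩
    refine ⟨fun i => i.elim0, isSRQstr_emptyPart B (fun θ hθ => ?_) _, χ fun i => i.elim0,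
      fun g _ => congrArg χ (funext fun i => i.elim0)⟩
    rw [← not_nonempty_iff]
    exact fun hB => h ⟨hB, θ, hθ⟩
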